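/- For every integer k ≥ 2 and every natural number i, there exists a finite oriented graph D_i whose underlying undirected graph has treewidth at most k, with exactly k+2+i(k+1) vertices, such that every (directed) feedback vertex set of D_i has size at least (i+1)·(k − 2·⌊log₂ k⌋). -/

import Mathlib

/-- A graph is a `k`-tree iff it admits a chordal elimination ordering in which the
earlier neighbors of every vertex `v` form a clique of size exactly `min k (φ v)`
(`φ` is 0-indexed). -/
def IsKTree {V : Type*} [Fintype V] (G : SimpleGraph V) (k : ℕ) : Prop :=
  ∃ φ : V ≃ Fin (Fintype.card V),
    ∀ v : V, G.IsClique {u | G.Adj v u ∧ (φ u : ℕ) < (φ v : ℕ)} ∧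
      ({u | G.Adj v u ∧ (φ u : ℕ) < (φ v : ℕ)}).ncard = min k (φ v : ℕ)

/-- A graph has treewidth at most `k` iff it is a subgraph of a `k`-tree. -/
def TreewidthLE {V : Type*} [Fintype V] (G : SimpleGraph V) (k : ℕ) : Prop :=
  ∃ H : SimpleGraph V, IsKTree H k ∧ G ≤ H

/-- `F` is a feedback vertex set of the digraph given by the arc relation `A`. -/
def DirFVS {V : Type*} (A : V → V → Prop) (F : Set V) : Prop :=
  ∀ v : V, ¬ Relation.TransGen (fun x y => x ∉ F ∧ y ∉ F ∧ A x y) v v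


/-! ### Part 1: the derandomised first moment argument -/

def TF (A : ℕ → ℕ → Prop) (S : Finset ℕ) : Prop :=
  ∀ u ∈ S, ∀ v ∈ S, ∀ w ∈ S, ¬ (A u v ∧ A v w ∧ A w u)

theorem TF.mono {A : ℕ → ℕ → Prop} {S T : Finset ℕ} (h : TF A T) (hST : S ⊆ T) : TF A S :=
  fun u hu v hv w hw => h u (hST hu) v (hST hv) w (hST hw)

def dg (k : ℕ) (S : Finset ℕ) (v : ℕ) : ℕ := (S.filter (fun u => u < v ∧ v ≤ u + k)).card

def uw (d : ℕ) : ℚ := (1 + d) / 2 ^ d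

theorem uw_nonneg (d : ℕ) : 0 ≤ uw d := by unfold uw; positivity

def pw (k : ℕ) (S : Finset ℕ) : ℚ := ∏ v ∈ S, uw (dg k S v)

theorem dg_insert (k N : ℕ) (S : Finset ℕ) (v : ℕ) (hv : v ≤ N) :
    dg k (insert N S) v = dg k S v := by
  unfold dg
  congr 1
  ext u
  simp only [Finset.mem_filter, Finset.mem_insert]
  constructor
  · rintro ⟨rfl | h, h2⟩
    · omega
    · exact ⟨h, h2⟩
  · rintro ⟨h, h2⟩
    exact ⟨Or.inr h, h2⟩

theorem pw_insert (k N : ℕ) (S : Finset ℕ) (hS : S ⊆ Finset.range N) :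
    pw k (insert N S) = uw (dg k S N) * pw k S := by
  have hN : N ∉ S := fun h => by simpa using hS h
  unfold pw
  rw [Finset.prod_insert hN, dg_insert k N S N le_rfl]
  congr 1
  apply Finset.prod_congr rfl
  intro v hv
  rw [dg_insert k N S v (by have := hS hv; simp at this; omega)]

def extA (A : ℕ → ℕ → Prop) (N : ℕ) (W X : Finset ℕ) (u v : ℕ) : Prop :=
  A u v ∨ (u = N ∧ v ∈ X) ∨ (v = N ∧ u ∈ W \ X)

theorem count_ext (k N : ℕ) (A : ℕ → ℕ → Prop) (W S : Finset ℕ)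
    (hW : W = (Finset.range N).filter (fun u => N ≤ u + k))
    (htot : ∀ u v, u < v → v < N → v ≤ u + k → A u v ∨ A v u)
    (P : Finset ℕ → Prop) [DecidablePred P]
    (hP : ∀ X, P X → TF (extA A N W X) (insert N S)) :
    (W.powerset.filter P).card ≤ (dg k S N + 1) * 2 ^ (W.card - dg k S N) := by
  have hd : dg k S N = (W ∩ S).card := by
    unfold dg
    congr 1
    ext u
    simp only [hW, Finset.mem_filter, Finset.mem_inter, Finset.mem_range]
    tauto
  have htot' : ∀ a ∈ W, ∀ b ∈ W, a ≠ b → A a b ∨ A b a := by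
    intro a ha b hb hab
    simp only [hW, Finset.mem_filter, Finset.mem_range] at ha hb
    rcases lt_or_gt_of_ne hab with h | h
    · exact htot a b h hb.1 (by omega)
    · exact (htot b a h ha.1 (by omega)).symm
  have hc : (dg k S N + 1) * 2 ^ (W.card - dg k S N)
      = (Finset.range (dg k S N + 1) ×ˢ (W \ S).powerset).card := by
    rw [Finset.card_product, Finset.card_range, Finset.card_powerset, Finset.card_sdiff,
      Finset.inter_comm S W, ← hd]
  rw [hc]
  apply Finset.card_le_card_of_injOn (fun X => ((X ∩ S).card, X \ S))
  · intro X hX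
    simp only [Finset.coe_filter, Finset.mem_powerset, Set.mem_ofPred_eq] at hX
    simp only [Finset.coe_product, Set.mem_prod, Finset.mem_coe, Finset.mem_range,
      Finset.mem_powerset]
    refine ⟨?_, Finset.sdiff_subset_sdiff hX.1 (Finset.Subset.refl _)⟩
    rw [hd]
    exact Nat.lt_succ_of_le (Finset.card_le_card (Finset.inter_subset_inter_right hX.1))
  · intro X hX Y hY hXY
    simp only [Finset.coe_filter, Finset.mem_powerset, Set.mem_ofPred_eq] at hX hY
    simp only [Prod.mk.injEq] at hXY
    obtain ⟨h1, h2⟩ := hXY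
    have hN : N ∈ insert N S := Finset.mem_insert_self _ _
    have key : ∀ X ⊆ W, P X → ∀ a ∈ X, a ∈ S → ∀ b ∈ W, b ∈ S → A a b → b ∈ X := by
      intro X hXW hPX a haX haS b hbW hbS hab
      by_contra hbX
      refine hP X hPX N hN a (Finset.mem_insert_of_mem haS) b (Finset.mem_insert_of_mem hbS) ?_
      refine ⟨Or.inr (Or.inl ⟨rfl, haX⟩), Or.inl hab, Or.inr (Or.inr ⟨rfl, ?_⟩)⟩
      simp [hbW, hbX]
    have hinter : X ∩ S = Y ∩ S := by
      by_cases hsub : X ∩ S ⊆ Y ∩ S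
      · exact Finset.eq_of_subset_of_card_le hsub h1.ge
      by_cases hsub' : Y ∩ S ⊆ X ∩ S
      · exact (Finset.eq_of_subset_of_card_le hsub' h1.le).symm
      exfalso
      obtain ⟨a, ha, ha'⟩ := Finset.not_subset.1 hsub
      obtain ⟨b, hb, hb'⟩ := Finset.not_subset.1 hsub'
      simp only [Finset.mem_inter] at ha ha' hb hb'
      have hab : a ≠ b := by rintro rfl; tauto
      rcases htot' a (hX.1 ha.1) b (hY.1 hb.1) hab with h | h
      · exact hb' ⟨key X hX.1 hX.2 a ha.1 ha.2 b (hY.1 hb.1) hb.2 h, hb.2⟩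
      · exact ha' ⟨key Y hY.1 hY.2 b hb.1 hb.2 a (hX.1 ha.1) ha.2 h, ha.2⟩
    rw [← Finset.sdiff_union_inter X S, ← Finset.sdiff_union_inter Y S, h2, hinter]

open Classical in
theorem averaging (k : ℕ) : ∀ (N : ℕ) (c : Finset ℕ → ℚ), (∀ S, 0 ≤ c S) →
    ∃ A : ℕ → ℕ → Prop, (∀ u v, A u v → ¬ A v u) ∧
      (∀ u v, A u v → u ≠ v ∧ u ≤ v + k ∧ v ≤ u + k) ∧
      (∀ u v, u < v → v < N → v ≤ u + k → A u v ∨ A v u) ∧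
      (∀ u v, A u v → u < N ∧ v < N) ∧
      ∑ S ∈ (Finset.range N).powerset, (if TF A S then c S else 0)
        ≤ ∑ S ∈ (Finset.range N).powerset, c S * pw k S := by
  intro N
  induction N with
  | zero =>
    intro c hc
    refine ⟨fun _ _ => False, by simp, by simp, by simp, by simp, ?_⟩
    simp only [Finset.range_zero, Finset.powerset_empty, Finset.sum_singleton]
    have : TF (fun _ _ => False) ∅ := by intro u hu; simp at hu
    simp [this, pw]
  | succ N ih =>
    intro c hc
    obtain ⟨A, h1, h2, h3, h4, h5⟩ := ih (fun S => c S + uw (dg k S N) * c (insert N S))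
      (fun S => add_nonneg (hc _) (mul_nonneg (uw_nonneg _) (hc _)))
    set W := (Finset.range N).filter (fun u => N ≤ u + k) with hW
    have hNr : N ∉ Finset.range N := by simp
    have hTFX : ∀ X ⊆ W, ∀ S ⊆ Finset.range N, (TF (extA A N W X) S ↔ TF A S) := by
      intro X hX S hS
      have : ∀ u ∈ S, ∀ v ∈ S, (extA A N W X u v ↔ A u v) := by
        intro u hu v hv
        have hu' := hS hu
        have hv' := hS hv
        simp only [Finset.mem_range] at hu' hv'
        unfold extA
        constructor
        · rintro (h | ⟨h, -⟩ | ⟨h, -⟩)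
          · exact h
          · omega
          · omega
        · exact Or.inl
      constructor
      · intro h u hu v hv w hw hh
        refine h u hu v hv w hw ?_
        rwa [this u hu v hv, this v hv w hw, this w hw u hu]
      · intro h u hu v hv w hw hh
        refine h u hu v hv w hw ?_
        rwa [this u hu v hv, this v hv w hw, this w hw u hu] at hh
    -- averaging
    have havg : ∑ X ∈ W.powerset, ∑ S ∈ (Finset.range N).powerset,
        (if TF (extA A N W X) (insert N S) then c (insert N S) else 0)
        ≤ ∑ X ∈ W.powerset, ∑ S ∈ (Finset.range N).powerset,
          (if TF A S then uw (dg k S N) * c (insert N S) else 0) := by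
      rw [Finset.sum_comm, Finset.sum_const, Finset.card_powerset, nsmul_eq_mul, Finset.mul_sum]
      apply Finset.sum_le_sum
      intro S hS
      rw [Finset.mem_powerset] at hS
      rw [← Finset.sum_filter, Finset.sum_const, nsmul_eq_mul]
      by_cases hTS : TF A S
      · rw [if_pos hTS, ← mul_assoc]
        refine mul_le_mul_of_nonneg_right ?_ (hc _)
        have := count_ext k N A W S hW h3 (fun X => TF (extA A N W X) (insert N S))
          (fun X h => h)
        have hle : dg k S N ≤ W.card := by
          unfold dg
          apply Finset.card_le_card
          intro u
          simp only [hW, Finset.mem_filter, Finset.mem_range]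
          tauto
        calc _ ≤ (((dg k S N + 1) * 2 ^ (W.card - dg k S N) : ℕ) : ℚ) := by exact_mod_cast this
          _ = _ := by
            unfold uw
            push_cast
            rw [pow_sub₀ _ (by norm_num) hle]
            field_simp
            ring
      · rw [if_neg hTS, mul_zero]
        have : (W.powerset.filter (fun X => TF (extA A N W X) (insert N S))) = ∅ := by
          apply Finset.filter_eq_empty_iff.2
          intro X hX h
          rw [Finset.mem_powerset] at hX
          exact hTS ((hTFX X hX S hS).1 (h.mono (Finset.subset_insert _ _)))
        rw [this]; simp
    obtain ⟨X, hX, hXle⟩ := Finset.exists_le_of_sum_le (⟨∅, by simp⟩) havg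
    rw [Finset.mem_powerset] at hX
    have hWmem : ∀ u ∈ W, u < N ∧ N ≤ u + k := by
      intro u hu; simpa [hW] using hu
    refine ⟨extA A N W X, ?_, ?_, ?_, ?_, ?_⟩
    · rintro u v (h | ⟨h, h'⟩ | ⟨h, h'⟩) (g | ⟨g, g'⟩ | ⟨g, g'⟩)
      · exact h1 _ _ h g
      · have := h4 _ _ h; omega
      · have := h4 _ _ h; omega
      · have := h4 _ _ g; omega
      · have := hWmem _ (hX h'); omega
      · simp only [Finset.mem_sdiff] at g'; tauto
      · have := h4 _ _ g; omega
      · simp only [Finset.mem_sdiff] at h'; tauto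
      · simp only [Finset.mem_sdiff] at h'; have := hWmem _ h'.1; omega
    · rintro u v (h | ⟨h, h'⟩ | ⟨h, h'⟩)
      · exact h2 _ _ h
      · have := hWmem _ (hX h'); omega
      · simp only [Finset.mem_sdiff] at h'; have := hWmem _ h'.1; omega
    · intro u v huv hv hvk
      rcases Nat.lt_succ_iff_lt_or_eq.1 hv with h | rfl
      · rcases h3 u v huv h hvk with h | h
        · exact Or.inl (Or.inl h)
        · exact Or.inr (Or.inl h)
      · by_cases huX : u ∈ X
        · exact Or.inr (Or.inr (Or.inl ⟨rfl, huX⟩))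
        · refine Or.inl (Or.inr (Or.inr ⟨rfl, ?_⟩))
          simp only [Finset.mem_sdiff, hW, Finset.mem_filter, Finset.mem_range]
          exact ⟨⟨huv, hvk⟩, huX⟩
    · rintro u v (h | ⟨h, h'⟩ | ⟨h, h'⟩)
      · have := h4 _ _ h; omega
      · have := hWmem _ (hX h'); omega
      · simp only [Finset.mem_sdiff] at h'; have := hWmem _ h'.1; omega
    · rw [Finset.range_add_one, Finset.sum_powerset_insert hNr, Finset.sum_powerset_insert hNr]
      have e1 : ∑ S ∈ (Finset.range N).powerset, (if TF (extA A N W X) S then c S else 0)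
          = ∑ S ∈ (Finset.range N).powerset, (if TF A S then c S else 0) := by
        apply Finset.sum_congr rfl
        intro S hS
        rw [Finset.mem_powerset] at hS
        simp only [hTFX X hX S hS]
      have e2 : ∑ S ∈ (Finset.range N).powerset, c (insert N S) * pw k (insert N S)
          = ∑ S ∈ (Finset.range N).powerset, uw (dg k S N) * c (insert N S) * pw k S := by
        apply Finset.sum_congr rfl
        intro S hS
        rw [Finset.mem_powerset] at hS
        rw [pw_insert k N S hS]; ring
      rw [e1, e2]
      refine le_trans (add_le_add_right hXle _) ?_
      rw [← Finset.sum_add_distrib, ← Finset.sum_add_distrib]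
      refine le_trans (le_of_eq ?_) (le_trans h5 (le_of_eq ?_))
      · apply Finset.sum_congr rfl
        intro S hS
        split_ifs <;> simp
      · apply Finset.sum_congr rfl
        intro S hS
        ring

def Good (k N f : ℕ) : Prop := ∃ A : ℕ → ℕ → Prop, (∀ u v, A u v → ¬ A v u) ∧
  (∀ u v, A u v → u ≠ v ∧ u ≤ v + k ∧ v ≤ u + k) ∧
  ∀ S ⊆ Finset.range N, TF A S → S.card ≤ f

/-- expected number of triangle-free sets of size `s` -/
def Ex (k N s : ℕ) : ℚ := ∑ S ∈ (Finset.range N).powersetCard s, pw k S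

theorem good_of_Ex (k N f : ℕ) (h : Ex k N (f + 1) < 1) : Good k N f := by
  classical
  obtain ⟨A, h1, h2, -, -, h5⟩ := averaging k N (fun S => if S.card = f + 1 then 1 else 0)
    (fun S => by positivity)
  refine ⟨A, h1, h2, ?_⟩
  intro S hS hTF
  by_contra hcard
  obtain ⟨T, hTS, hT⟩ := Finset.exists_subset_card_eq (show f + 1 ≤ S.card by omega)
  have hE : Ex k N (f + 1) = ∑ S ∈ (Finset.range N).powerset,
      (if S.card = f + 1 then (1 : ℚ) else 0) * pw k S := by
    unfold Ex
    rw [Finset.powersetCard_eq_filter, Finset.sum_filter]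
    apply Finset.sum_congr rfl
    intro S _
    split_ifs <;> simp
  have : (1 : ℚ) ≤ ∑ S ∈ (Finset.range N).powerset,
      (if TF A S then (if S.card = f + 1 then (1 : ℚ) else 0) else 0) := by
    have := Finset.single_le_sum (f := fun S => (if TF A S then
      (if S.card = f + 1 then (1 : ℚ) else 0) else 0)) (s := (Finset.range N).powerset)
      (fun S _ => by positivity) (Finset.mem_powerset.2 (hTS.trans hS))
    simpa [hTF.mono hTS, hT] using this
  linarith


/-! ### Part 2: combining pieces, and the final assembly -/

theorem good_one (k : ℕ) : Good k 1 1 :=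
  ⟨fun _ _ => False, by simp, by simp, fun S hS _ => by simpa using Finset.card_le_card hS⟩

theorem good_add (k N1 f1 N2 f2 : ℕ) (h1 : Good k N1 f1) (h2 : Good k N2 f2) :
    Good k (N1 + N2) (f1 + f2) := by
  obtain ⟨A, a1, a2, a3⟩ := h1
  obtain ⟨B, b1, b2, b3⟩ := h2
  refine ⟨fun u v => (u < N1 ∧ v < N1 ∧ A u v) ∨ (N1 ≤ u ∧ N1 ≤ v ∧ B (u - N1) (v - N1)),
    ?_, ?_, ?_⟩
  · rintro u v (⟨h, h', h''⟩ | ⟨h, h', h''⟩) (⟨g, g', g''⟩ | ⟨g, g', g''⟩)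
    · exact a1 _ _ h'' g''
    · omega
    · omega
    · exact b1 _ _ h'' g''
  · rintro u v (⟨h, h', h''⟩ | ⟨h, h', h''⟩)
    · exact a2 _ _ h''
    · have := b2 _ _ h''; omega
  · intro S hS hTF
    have hsplit := Finset.card_filter_add_card_filter_not (s := S) (fun u => u < N1)
    have c1 : (S.filter (fun u => u < N1)).card ≤ f1 := by
      apply a3
      · intro u hu; simp only [Finset.mem_filter] at hu; simpa using hu.2
      · intro u hu v hv w hw hh
        simp only [Finset.mem_filter] at hu hv hw
        exact hTF u hu.1 v hv.1 w hw.1 ⟨Or.inl ⟨hu.2, hv.2, hh.1⟩, Or.inl ⟨hv.2, hw.2, hh.2.1⟩,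
          Or.inl ⟨hw.2, hu.2, hh.2.2⟩⟩
    have c2 : (S.filter (fun u => ¬ u < N1)).card ≤ f2 := by
      have hinj : Set.InjOn (fun u => u - N1) (S.filter (fun u => ¬ u < N1)) := by
        intro u hu v hv huv
        simp only [Finset.coe_filter, Set.mem_ofPred_eq] at hu hv huv
        omega
      rw [← Finset.card_image_of_injOn hinj]
      apply b3
      · intro u hu
        simp only [Finset.mem_image, Finset.mem_filter] at hu
        obtain ⟨x, hx, rfl⟩ := hu
        have := hS hx.1
        simp only [Finset.mem_range] at this ⊢
        omega
      · intro u hu v hv w hw hh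
        simp only [Finset.mem_image, Finset.mem_filter] at hu hv hw
        obtain ⟨x, hx, rfl⟩ := hu
        obtain ⟨y, hy, rfl⟩ := hv
        obtain ⟨z, hz, rfl⟩ := hw
        exact hTF x hx.1 y hy.1 z hz.1 ⟨Or.inr ⟨by omega, by omega, hh.1⟩,
          Or.inr ⟨by omega, by omega, hh.2.1⟩, Or.inr ⟨by omega, by omega, hh.2.2⟩⟩
    omega

theorem good_mul (k N f j : ℕ) (h : Good k N f) : Good k (j * N) (j * f) := by
  induction j with
  | zero => exact ⟨fun _ _ => False, by simp, by simp, fun S hS _ => by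
      simpa using Finset.card_le_card hS⟩
  | succ j ih =>
    have := good_add k _ _ _ _ ih h
    simpa [Nat.succ_mul] using this

theorem good_total (k m i : ℕ) (hm : 1 ≤ m) (h1 : Good k (k + 2) (2 * m))
    (h2 : Good k (2 * (k + 1)) (4 * m - 2)) :
    Good k (k + 2 + i * (k + 1)) ((i + 1) * (2 * m - 1) + 1) := by
  obtain ⟨m, rfl⟩ : ∃ m', m = m' + 1 := ⟨m - 1, by omega⟩
  rcases Nat.even_or_odd' i with ⟨j, rfl | rfl⟩
  · have := good_add k _ _ _ _ h1 (good_mul k _ _ j h2)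
    convert this using 1
    · ring
    · have e1 : 4 * (m + 1) - 2 = 4 * m + 2 := by omega
      have e2 : 2 * (m + 1) - 1 = 2 * m + 1 := by omega
      rw [e1, e2]; ring
  · have := good_add k _ _ _ _ (good_one k) (good_mul k _ _ (j + 1) h2)
    convert this using 1
    · ring
    · have e1 : 4 * (m + 1) - 2 = 4 * m + 2 := by omega
      have e2 : 2 * (m + 1) - 1 = 2 * m + 1 := by omega
      rw [e1, e2]; ring

def pathPow (k N : ℕ) : SimpleGraph (Fin N) where
  Adj u v := u ≠ v ∧ (u : ℕ) ≤ v + k ∧ (v : ℕ) ≤ u + k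
  symm := ⟨fun _ _ h => ⟨h.1.symm, h.2.2, h.2.1⟩⟩
  loopless := ⟨fun _ h => h.1 rfl⟩

theorem pathPow_ktree (k N : ℕ) : IsKTree (pathPow k N) k := by
  refine ⟨finCongr (by simp), ?_⟩
  intro v
  constructor
  · intro a ha b hb hab
    simp only [Set.mem_ofPred_eq, pathPow, finCongr_apply, Fin.val_cast] at ha hb ⊢
    refine ⟨hab, ?_, ?_⟩ <;> omega
  · have : {u : Fin N | (pathPow k N).Adj v u ∧
        ((finCongr (by simp : N = Fintype.card (Fin N))) u : ℕ)
          < ((finCongr (by simp : N = Fintype.card (Fin N))) v : ℕ)}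
        = ((Finset.univ.filter (fun u : Fin N => (u : ℕ) ∈ Finset.Ico ((v : ℕ) - k) v) :
          Finset (Fin N)) : Set (Fin N)) := by
      ext u
      simp only [Set.mem_ofPred_eq, pathPow, finCongr_apply, Fin.val_cast, Finset.coe_filter,
        Finset.mem_univ, true_and, Finset.mem_Ico, ne_eq, Fin.ext_iff]
      omega
    rw [this, Set.ncard_coe_finset]
    have hc : (Finset.univ.filter (fun u : Fin N => (u : ℕ) ∈ Finset.Ico ((v : ℕ) - k) v)).card
        = (Finset.Ico ((v : ℕ) - k) v).card := by
      rw [← Finset.card_map Fin.valEmbedding]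
      congr 1
      ext x
      simp only [Finset.mem_map, Finset.mem_filter, Finset.mem_univ, true_and,
        Fin.valEmbedding_apply, Finset.mem_Ico]
      constructor
      · rintro ⟨u, hu, rfl⟩; exact hu
      · intro hx; exact ⟨⟨x, by have := v.2; omega⟩, hx, rfl⟩
    rw [hc, Nat.card_Ico]
    simp only [finCongr_apply, Fin.val_cast]
    omega

theorem final_of_good (k N f : ℕ) (h : Good k N f) :
    ∃ A : Fin N → Fin N → Prop, (∀ u v, A u v → ¬ A v u) ∧
      TreewidthLE (SimpleGraph.fromRel A) k ∧
      ∀ F : Set (Fin N), DirFVS A F → N - f ≤ F.ncard := by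
  classical
  obtain ⟨A, a1, a2, a3⟩ := h
  refine ⟨fun u v => A u v, fun u v => a1 u v, ⟨pathPow k N, pathPow_ktree k N, ?_⟩, ?_⟩
  · intro u v huv
    rw [SimpleGraph.fromRel_adj] at huv
    obtain ⟨hne, h | h⟩ := huv
    · exact ⟨hne, (a2 _ _ h).2⟩
    · exact ⟨hne, (a2 _ _ h).2.2, (a2 _ _ h).2.1⟩
  · intro F hF
    set S : Finset ℕ := (Finset.univ.filter (fun u : Fin N => u ∉ F)).map Fin.valEmbedding with hS
    have hmem : ∀ x ∈ S, ∃ u : Fin N, u ∉ F ∧ (u : ℕ) = x := by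
      intro x hx
      simpa [hS] using hx
    have hc : S.card ≤ f := by
      apply a3
      · intro x hx
        obtain ⟨u, -, rfl⟩ := hmem x hx
        simp
      · intro x hx y hy z hz hh
        obtain ⟨u, hu, rfl⟩ := hmem x hx
        obtain ⟨v, hv, rfl⟩ := hmem y hy
        obtain ⟨w, hw, rfl⟩ := hmem z hz
        exact hF u (Relation.TransGen.tail (Relation.TransGen.tail
          (Relation.TransGen.single ⟨hu, hv, hh.1⟩) ⟨hv, hw, hh.2.1⟩) ⟨hw, hu, hh.2.2⟩)
    rw [hS, Finset.card_map] at hc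
    have hsplit := Finset.card_filter_add_card_filter_not (s := (Finset.univ : Finset (Fin N)))
      (fun u => u ∉ F)
    have hFc : F.ncard = (Finset.univ.filter (fun u : Fin N => ¬ u ∉ F)).card := by
      rw [← Set.ncard_coe_finset]
      congr 1
      ext u
      simp
    rw [hFc]
    simp only [Finset.card_univ, Fintype.card_fin] at hsplit
    omega

theorem main_of_Ex (k i : ℕ)
    (h1 : Ex k (k + 2) (2 * (Nat.log 2 k + 1) + 1) < 1)
    (h2 : Ex k (2 * (k + 1)) (4 * (Nat.log 2 k + 1) - 1) < 1) :
    ∃ A : Fin (k + 2 + i * (k + 1)) → Fin (k + 2 + i * (k + 1)) → Prop,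
      (∀ u v, A u v → ¬ A v u) ∧
      TreewidthLE (SimpleGraph.fromRel A) k ∧
      ∀ F : Set (Fin (k + 2 + i * (k + 1))), DirFVS A F →
        (i + 1) * (k - 2 * Nat.log 2 k) ≤ F.ncard := by
  revert h1 h2
  generalize Nat.log 2 k = L
  intro h1 h2
  have g := good_total k (L + 1) i (by omega) (good_of_Ex _ _ _ h1) (good_of_Ex _ _ _ (by
    have : 4 * (L + 1) - 2 + 1 = 4 * (L + 1) - 1 := by omega
    rw [this]; exact h2))
  obtain ⟨A, h1, h2, h3⟩ := final_of_good _ _ _ g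
  refine ⟨A, h1, h2, fun F hF => le_trans ?_ (h3 F hF)⟩
  have e : 2 * (L + 1) - 1 = 2 * L + 1 := by omega
  rw [e]
  rcases le_total (2 * L) k with h | h
  · apply Nat.le_sub_of_add_le
    obtain ⟨r, rfl⟩ := Nat.exists_eq_add_of_le h
    rw [Nat.add_sub_cancel_left]
    apply le_of_eq; ring
  · simp [Nat.sub_eq_zero_of_le h]


/-! ### Part 3: the piece with `k + 2` vertices -/

def UU (t : ℕ) : ℚ := ∏ j ∈ Finset.range t, uw j

theorem UU_succ (t : ℕ) : UU (t + 1) = UU t * uw t := Finset.prod_range_succ _ _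

theorem UU_nonneg (t : ℕ) : 0 ≤ UU t := Finset.prod_nonneg fun _ _ => uw_nonneg _

theorem UU_eq (t : ℕ) : UU t * 2 ^ (t.choose 2) = t.factorial := by
  induction t with
  | zero => simp [UU]
  | succ t ih =>
    rw [UU_succ, Nat.choose_succ_succ' t 1, Nat.choose_one_right, pow_add, Nat.factorial_succ]
    push_cast
    rw [← ih]
    unfold uw
    field_simp
    ring

theorem dg_eq_card (k a : ℕ) (S : Finset ℕ) (h : ∀ x ∈ S, x < a) (ha : ∀ x ∈ S, a ≤ x + k) :
    dg k S a = S.card := by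
  unfold dg
  congr 1
  apply Finset.filter_true_of_mem
  intro x hx
  exact ⟨h x hx, ha x hx⟩

theorem pw_small (k : ℕ) (S : Finset ℕ) : S ⊆ Finset.range (k + 1) → pw k S = UU S.card := by
  induction S using Finset.induction_on_max with
  | empty => intro _; simp [pw, UU]
  | insert a s hs ih =>
    intro h
    rw [Finset.insert_subset_iff] at h
    have hn : a ∉ s := fun hh => lt_irrefl _ (hs a hh)
    rw [pw_insert k a s (fun x hx => by simpa using hs x hx), ih h.2, Finset.card_insert_of_notMem hn,
      UU_succ, dg_eq_card k a s hs (fun x hx => by have := h.1; simp at this; omega), mul_comm]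

theorem sum_pc_succ {M : Type*} [AddCommMonoid M] (N t : ℕ) (g : Finset ℕ → M) :
    ∑ S ∈ (Finset.range (N + 1)).powersetCard (t + 1), g S
      = ∑ S ∈ (Finset.range N).powersetCard (t + 1), g S
        + ∑ S ∈ (Finset.range N).powersetCard t, g (insert N S) := by
  have hN : N ∉ Finset.range N := by simp
  rw [Finset.range_add_one, Finset.powersetCard_succ_insert hN, Finset.sum_union, Finset.sum_image]
  · intro S hS T hT h
    rw [Finset.mem_coe, Finset.mem_powersetCard] at hS hT
    have hS' : N ∉ S := fun h => hN (hS.1 h)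
    have hT' : N ∉ T := fun h => hN (hT.1 h)
    rw [← Finset.erase_insert hS', ← Finset.erase_insert hT', h]
  · rw [Finset.disjoint_left]
    intro S hS hS'
    simp only [Finset.mem_powersetCard, Finset.mem_image] at hS hS'
    obtain ⟨T, -, rfl⟩ := hS'
    exact hN (hS.1 (Finset.mem_insert_self _ _))

theorem uw_pred (s : ℕ) : uw s ≤ 2 * uw (s + 1) := by
  unfold uw
  rw [pow_succ]
  have : (0 : ℚ) < 2 ^ s := by positivity
  rw [mul_div_assoc', div_le_div_iff₀ (by positivity) (by positivity)]
  push_cast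
  nlinarith

theorem Ex1_le (k t : ℕ) :
    Ex k (k + 2) (t + 2) ≤ UU (t + 2) * ((k + 2).choose (t + 2) + k.choose t) := by
  unfold Ex
  rw [sum_pc_succ]
  have e1 : ∑ S ∈ (Finset.range (k + 1)).powersetCard (t + 1 + 1), pw k S
      = UU (t + 2) * (k + 1).choose (t + 2) := by
    rw [Finset.sum_congr rfl (g := fun _ => UU (t + 2))]
    · rw [Finset.sum_const, Finset.card_powersetCard, Finset.card_range, nsmul_eq_mul, mul_comm]
    · intro S hS
      rw [Finset.mem_powersetCard] at hS
      rw [pw_small k S hS.1, hS.2]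
  have e2 : ∑ S ∈ (Finset.range (k + 1)).powersetCard (t + 1), pw k (insert (k + 1) S)
      ≤ ∑ S ∈ (Finset.range (k + 1)).powersetCard (t + 1),
        UU (t + 2) * (1 + if 0 ∈ S then 1 else 0) := by
    apply Finset.sum_le_sum
    intro S hS
    rw [Finset.mem_powersetCard] at hS
    rw [pw_insert k (k + 1) S hS.1, pw_small k S hS.1, hS.2, UU_succ (t + 1), mul_comm, mul_assoc]
    apply mul_le_mul_of_nonneg_left _ (UU_nonneg _)
    split_ifs with h0
    · have : dg k S (k + 1) = t := by
        unfold dg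
        have : S.filter (fun u => u < k + 1 ∧ k + 1 ≤ u + k) = S.erase 0 := by
          ext x
          simp only [Finset.mem_filter, Finset.mem_erase]
          constructor
          · rintro ⟨h, h'⟩; exact ⟨by omega, h⟩
          · rintro ⟨h, h'⟩
            have := hS.1 h'
            simp only [Finset.mem_range] at this
            exact ⟨h', by omega, by omega⟩
        rw [this, Finset.card_erase_of_mem h0, hS.2]
        simp
      rw [this]
      linarith [uw_pred t]
    · rw [dg_eq_card, hS.2]
      · simp
      · intro x hx; simpa using hS.1 hx
      · intro x hx
        have : x ≠ 0 := by rintro rfl; exact h0 hx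
        omega
  have e3 : ∑ S ∈ (Finset.range (k + 1)).powersetCard (t + 1),
        UU (t + 2) * (1 + if 0 ∈ S then (1 : ℚ) else 0)
      = UU (t + 2) * ((k + 1).choose (t + 1) + k.choose t) := by
    rw [← Finset.mul_sum, Finset.sum_add_distrib]
    congr 1
    congr 1
    · simp
    · rw [← Finset.sum_filter]
      have h1 := Finset.card_filter_add_card_filter_not
        (s := (Finset.range (k + 1)).powersetCard (t + 1)) (fun S => 0 ∈ S)
      have h2 : ((Finset.range (k + 1)).powersetCard (t + 1)).filter (fun S => ¬ 0 ∈ S)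
          = ((Finset.range (k + 1)).erase 0).powersetCard (t + 1) := by
        ext S
        simp only [Finset.mem_filter, Finset.mem_powersetCard, Finset.subset_erase]
        tauto
      rw [h2] at h1
      simp only [Finset.card_powersetCard, Finset.card_range] at h1
      rw [Finset.card_erase_of_mem (by simp), Finset.card_range, Nat.choose_succ_succ',
        Nat.add_sub_cancel] at h1
      simp only [Finset.sum_const, nsmul_eq_mul, mul_one]
      norm_cast
      omega
  rw [e1]
  rw [e3] at e2
  have : ((k + 2).choose (t + 2) : ℚ) = (k + 1).choose (t + 1) + (k + 1).choose (t + 2) := by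
    exact_mod_cast Nat.choose_succ_succ' (k + 1) (t + 1)
  rw [this]
  linarith

theorem desc_aux (q r : ℕ) : Nat.descFactorial q r * (2 * (q + 1) + r * (r + 1))
    ≤ 2 * (q + 1) ^ (r + 1) := by
  induction r with
  | zero => simp
  | succ r ih =>
    rw [Nat.descFactorial_succ]
    rcases le_total q r with h | h
    · rw [Nat.sub_eq_zero_of_le h]; simp
    · obtain ⟨d, rfl⟩ := Nat.exists_eq_add_of_le h
      rw [Nat.add_sub_cancel_left, pow_succ]
      generalize Nat.descFactorial (r + d) r = D at *
      calc d * D * (2 * (r + d + 1) + (r + 1) * (r + 1 + 1))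
          ≤ D * (2 * (r + d + 1) + r * (r + 1)) * (r + d + 1) := by
            have : d * (2 * (r + d + 1) + (r + 1) * (r + 1 + 1)) ≤
              (2 * (r + d + 1) + r * (r + 1)) * (r + d + 1) := by
                nlinarith [Nat.zero_le (r * r * r), Nat.zero_le (d * r), Nat.zero_le (r * r),
                  Nat.zero_le (d*d), Nat.zero_le (d * r * r)]
            calc _ = D * (d * (2 * (r + d + 1) + (r + 1) * (r + 1 + 1))) := by ring
              _ ≤ D * ((2 * (r + d + 1) + r * (r + 1)) * (r + d + 1)) := Nat.mul_le_mul_left _ this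
              _ = _ := by ring
        _ ≤ 2 * (r + d + 1) ^ (r + 1) * (r + d + 1) := Nat.mul_le_mul_right _ ih
        _ = _ := by ring

theorem ineq1 (k m : ℕ) (hm : 2 ≤ m) (hk : k + 1 ≤ 2 ^ m) :
    Nat.descFactorial k (2 * m - 1) * ((k + 2) * (k + 1) + (2 * m + 1) * (2 * m))
      < 2 ^ (m * (2 * m + 1)) := by
  obtain ⟨q, hq⟩ : ∃ q, 2 ^ m = q + 1 := ⟨2 ^ m - 1, by have := Nat.one_le_two_pow (n := m); omega⟩
  rw [pow_mul, hq]
  rw [hq] at hk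
  have hkq : k ≤ q := by omega
  have hmono : Nat.descFactorial k (2 * m - 1) * ((k + 2) * (k + 1) + (2 * m + 1) * (2 * m))
      ≤ Nat.descFactorial q (2 * m - 1) * ((q + 2) * (q + 1) + (2 * m + 1) * (2 * m)) := by
    apply Nat.mul_le_mul (Nat.descFactorial_le _ hkq)
    gcongr
  refine lt_of_le_of_lt hmono ?_
  rcases Nat.lt_or_ge m 3 with h3 | h3
  · have : m = 2 := by omega
    subst this
    have : q = 3 := by omega
    subst this
    decide
  · have h8 : 8 ≤ q + 1 := by
      rw [← hq]
      calc 8 = 2 ^ 3 := by norm_num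
        _ ≤ _ := Nat.pow_le_pow_right (by norm_num) h3
    have := desc_aux q (2 * m - 1)
    rw [show 2 * m - 1 + 1 = 2 * m by omega] at this
    generalize Nat.descFactorial q (2 * m - 1) = D at *
    obtain ⟨l, rfl⟩ := Nat.exists_eq_add_of_le h3
    rw [show 2 * (3 + l) - 1 = 2 * l + 5 by omega] at this
    rcases Nat.eq_zero_or_pos D with rfl | hD
    · simp
    · have h1 : (q + 2) * (q + 1) + (2 * (3 + l) + 1) * (2 * (3 + l)) <
        ((q + 1) + (2 * l + 5) * (3 + l)) * (q + 1) := by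
        nlinarith [Nat.mul_le_mul_left ((2 * l + 5) * (3 + l) - 1) h8, Nat.zero_le (l * q), Nat.zero_le (l * l * q)]
      calc _ < D * (((q + 1) + (2 * l + 5) * (3 + l)) * (q + 1)) := Nat.mul_lt_mul_of_pos_left h1 hD
        _ = D * (((q + 1) + (2 * l + 5) * (3 + l))) * (q + 1) := by ring
        _ ≤ (q + 1) ^ (2 * (3 + l)) * (q + 1) := by
          apply Nat.mul_le_mul_right
          nlinarith
        _ = _ := by ring

theorem Ex1_lt (k m : ℕ) (hm : 2 ≤ m) (hk : k + 1 ≤ 2 ^ m) : Ex k (k + 2) (2 * m + 1) < 1 := by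
  have h := ineq1 k m hm hk
  obtain ⟨t, ht⟩ : ∃ t, 2 * m - 1 = t := ⟨_, rfl⟩
  have ht2 : 2 * m + 1 = t + 2 := by omega
  have hle := Ex1_le k t
  have hU := UU_eq (t + 2)
  have hch : (t + 2).choose 2 = m * (2 * m + 1) := by
    rw [← ht2, Nat.choose_two_right, Nat.add_sub_cancel]
    rw [show (2 * m + 1) * (2 * m) = 2 * (m * (2 * m + 1)) by ring]
    simp
  rw [hch] at hU
  rw [ht2]
  refine lt_of_le_of_lt hle ?_
  have hP : (0 : ℚ) < 2 ^ (m * (2 * m + 1)) := by positivity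
  have e : UU (t + 2) * ((k + 2).choose (t + 2) + k.choose t) * 2 ^ (m * (2 * m + 1))
      < 1 * 2 ^ (m * (2 * m + 1)) := by
    rw [one_mul, mul_right_comm, hU]
    have d1 : (t + 2).factorial * (k + 2).choose (t + 2) = (k + 2) * ((k + 1) * k.descFactorial t) := by
      rw [← Nat.descFactorial_eq_factorial_mul_choose, Nat.succ_descFactorial_succ,
        Nat.succ_descFactorial_succ]
    have d2 : (t + 2).factorial * k.choose t = (t + 2) * ((t + 1) * k.descFactorial t) := by
      rw [Nat.descFactorial_eq_factorial_mul_choose, Nat.factorial_succ, Nat.factorial_succ]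
      ring
    have : (t + 2).factorial * ((k + 2).choose (t + 2) + k.choose t) < 2 ^ (m * (2 * m + 1)) := by
      rw [mul_add, d1, d2]
      rw [ht, ht2, show 2 * m = t + 1 by omega] at h
      rw [show m * (t + 1 + 1) = m * (2 * m + 1) by rw [ht2]] at *
      linarith
    exact_mod_cast this
  exact lt_of_mul_lt_mul_right e hP.le


/-! ### Part 4: the piece with `2 * (k + 1)` vertices, reduction to a recursion -/

def ww (r c : ℕ) : ℚ := (r + 1 + c) / ((r + 1) * 2 ^ c)

theorem ww_nonneg (r c : ℕ) : 0 ≤ ww r c := by unfold ww; positivity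

theorem uw_add (r c : ℕ) : uw (r + c) = uw r * ww r c := by
  unfold uw ww
  rw [pow_add]
  have : (1 + (r : ℚ)) ≠ 0 := by positivity
  have : ((r : ℚ) + 1) ≠ 0 := by positivity
  field_simp
  push_cast
  ring

def rk (Y : Finset ℕ) (y : ℕ) : ℕ := (Y.filter (fun z => z < y)).card
def ck (X : Finset ℕ) (y : ℕ) : ℕ := (X.filter (fun x => y < x)).card

def GG (X Y : Finset ℕ) (e : ℕ) : ℚ := ∏ y ∈ Y, ww (rk Y y) (e + ck X y)

def FF (n a b e : ℕ) : ℚ :=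
  ∑ X ∈ (Finset.range n).powersetCard a, ∑ Y ∈ (Finset.range n).powersetCard b, GG X Y e

theorem prod_rk (Y : Finset ℕ) : ∏ y ∈ Y, uw (rk Y y) = UU Y.card := by
  induction Y using Finset.induction_on_max with
  | empty => simp [UU]
  | insert a s hs ih =>
    have hn : a ∉ s := fun hh => lt_irrefl _ (hs a hh)
    rw [Finset.prod_insert hn, Finset.card_insert_of_notMem hn, UU_succ, mul_comm, ← ih]
    congr 1
    · apply Finset.prod_congr rfl
      intro y hy
      congr 1
      unfold rk
      rw [Finset.filter_insert, if_neg (by have := hs y hy; omega)]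
    · congr 1
      unfold rk
      rw [Finset.filter_insert, if_neg (lt_irrefl _), Finset.filter_true_of_mem hs]

def shiftEmb (n : ℕ) : ℕ ↪ ℕ := ⟨fun y => y + n, fun _ _ h => by simpa using h⟩

theorem shiftEmb_apply (n y : ℕ) : shiftEmb n y = y + n := rfl

theorem pw_union (k : ℕ) (X Y : Finset ℕ) (hX : X ⊆ Finset.range (k + 1))
    (hY : Y ⊆ Finset.range (k + 1)) :
    pw k (X ∪ Y.map (shiftEmb (k + 1))) = UU X.card * UU Y.card * GG X Y 0 := by
  have hdis : Disjoint X (Y.map (shiftEmb (k + 1))) := by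
    rw [Finset.disjoint_left]
    intro x hx hx'
    simp only [Finset.mem_map, shiftEmb_apply] at hx'
    obtain ⟨y, -, rfl⟩ := hx'
    have := hX hx
    simp at this
    omega
  have hdX : ∀ x ∈ X, dg k (X ∪ Y.map (shiftEmb (k + 1))) x = dg k X x := by
    intro x hx
    unfold dg
    congr 1
    have := hX hx
    simp only [Finset.mem_range] at this
    ext u
    simp only [Finset.mem_filter, Finset.mem_union, Finset.mem_map, shiftEmb_apply]
    constructor
    · rintro ⟨h | ⟨y, hy, rfl⟩, h2⟩
      · exact ⟨h, h2⟩
      · omega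
    · rintro ⟨h, h2⟩
      exact ⟨Or.inl h, h2⟩
  have hdY : ∀ y ∈ Y, dg k (X ∪ Y.map (shiftEmb (k + 1))) (y + (k + 1)) = rk Y y + (0 + ck X y) := by
    intro y hy
    have hyk := hY hy
    simp only [Finset.mem_range] at hyk
    unfold dg rk ck
    rw [Finset.filter_union, Finset.card_union_of_disjoint (Finset.disjoint_filter_filter hdis),
      zero_add, add_comm]
    congr 1
    · rw [Finset.filter_map, Finset.card_map]
      congr 1
      ext u
      simp only [Finset.mem_filter, Function.comp, shiftEmb_apply]
      constructor
      · rintro ⟨h, h2⟩; exact ⟨h, by omega⟩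
      · rintro ⟨h, h2⟩; exact ⟨h, by omega, by omega⟩
    · congr 1
      ext u
      simp only [Finset.mem_filter]
      constructor
      · rintro ⟨h, h2⟩; exact ⟨h, by omega⟩
      · rintro ⟨h, h2⟩
        have := hX h
        simp only [Finset.mem_range] at this
        exact ⟨h, by omega, by omega⟩
  have h1 : pw k (X ∪ Y.map (shiftEmb (k + 1))) = (∏ x ∈ X, uw (dg k X x)) *
      ∏ y ∈ Y, uw (rk Y y + (0 + ck X y)) := by
    unfold pw
    rw [Finset.prod_union hdis, Finset.prod_map]
    congr 1
    · exact Finset.prod_congr rfl fun x hx => by rw [hdX x hx]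
    · exact Finset.prod_congr rfl fun y hy => by rw [← hdY y hy]; rfl
  rw [h1]
  simp only [uw_add]
  rw [Finset.prod_mul_distrib, prod_rk]
  have := pw_small k X hX
  unfold pw at this
  rw [this, mul_assoc]
  rfl

theorem sum_split {M : Type*} [AddCommMonoid M] (n N : ℕ) (g : Finset ℕ → M) :
    ∑ S ∈ (Finset.range (n + N)).powerset, g S
      = ∑ Y ∈ (Finset.range N).powerset, ∑ X ∈ (Finset.range n).powerset,
        g (X ∪ Y.map (shiftEmb n)) := by
  induction N generalizing g with
  | zero => simp
  | succ N ih =>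
    have h1 : n + N ∉ Finset.range (n + N) := by simp
    have h2 : N ∉ Finset.range N := by simp
    rw [← add_assoc, Finset.range_add_one, Finset.sum_powerset_insert h1, ih g,
      ih (fun S => g (insert (n + N) S)), Finset.range_add_one, Finset.sum_powerset_insert h2]
    congr 1
    apply Finset.sum_congr rfl
    intro Y _
    apply Finset.sum_congr rfl
    intro X _
    congr 1
    rw [Finset.map_insert, Finset.union_insert]
    congr 1
    simp [shiftEmb_apply, add_comm]

theorem Ex2_eq (k T : ℕ) : Ex k (2 * (k + 1)) T
    = ∑ t ∈ Finset.range (T + 1), UU t * UU (T - t) * FF (k + 1) t (T - t) 0 := by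
  have h0 : Ex k (2 * (k + 1)) T = ∑ S ∈ (Finset.range ((k + 1) + (k + 1))).powerset,
      if S.card = T then pw k S else 0 := by
    unfold Ex
    rw [Finset.powersetCard_eq_filter, Finset.sum_filter, two_mul]
  rw [h0, sum_split, Finset.sum_comm]
  have h1 : ∀ X ∈ (Finset.range (k + 1)).powerset, ∀ Y ∈ (Finset.range (k + 1)).powerset,
      (if (X ∪ Y.map (shiftEmb (k + 1))).card = T then pw k (X ∪ Y.map (shiftEmb (k + 1))) else 0)
      = ∑ t ∈ Finset.range (T + 1), if X.card = t then (if Y.card = T - t then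
          UU t * UU (T - t) * GG X Y 0 else 0) else 0 := by
    intro X hX Y hY
    rw [Finset.mem_powerset] at hX hY
    have hdis : Disjoint X (Y.map (shiftEmb (k + 1))) := by
      rw [Finset.disjoint_left]
      intro x hx hx'
      simp only [Finset.mem_map, shiftEmb_apply] at hx'
      obtain ⟨y, -, rfl⟩ := hx'
      have := hX hx
      simp at this
      omega
    rw [Finset.card_union_of_disjoint hdis, Finset.card_map, pw_union k X Y hX hY, Finset.sum_ite_eq]
    by_cases h : X.card + Y.card = T
    · have h' : Y.card = T - X.card := by omega
      rw [if_pos h, if_pos (by simp; omega), if_pos h', h']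
    · rw [if_neg h]
      split_ifs with h2 h3
      · simp only [Finset.mem_range] at h2; omega
      · rfl
      · rfl
  rw [Finset.sum_congr rfl fun X hX => Finset.sum_congr rfl fun Y hY => h1 X hX Y hY]
  rw [Finset.sum_congr rfl fun X hX => Finset.sum_comm, Finset.sum_comm]
  apply Finset.sum_congr rfl
  intro t _
  unfold FF
  rw [Finset.powersetCard_eq_filter, Finset.sum_filter, Finset.mul_sum]
  apply Finset.sum_congr rfl
  intro X _
  by_cases hX : X.card = t
  · simp only [if_pos hX]
    rw [Finset.powersetCard_eq_filter, Finset.sum_filter, Finset.mul_sum]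
    apply Finset.sum_congr rfl
    intro Y _
    simp
  · simp [hX]

theorem GG_insX (n e : ℕ) (X Y : Finset ℕ) (hX : X ⊆ Finset.range n) (hY : Y ⊆ Finset.range n) :
    GG (insert n X) Y e = GG X Y (e + 1) := by
  unfold GG
  apply Finset.prod_congr rfl
  intro y hy
  congr 1
  have h1 := hY hy
  simp only [Finset.mem_range] at h1
  have h2 : n ∉ X := fun h => by simpa using hX h
  unfold ck
  rw [Finset.filter_insert, if_pos h1, Finset.card_insert_of_notMem (by simp [h2])]
  ring

theorem GG_insY (n e : ℕ) (X Y : Finset ℕ) (hX : X ⊆ Finset.range (n + 1)) (hY : Y ⊆ Finset.range n) :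
    GG X (insert n Y) e = ww Y.card e * GG X Y e := by
  unfold GG
  have h2 : n ∉ Y := fun h => by simpa using hY h
  have h3 : ∀ y ∈ Y, y < n := fun y hy => by simpa using hY hy
  rw [Finset.prod_insert h2]
  congr 1
  · congr 1
    · unfold rk
      rw [Finset.filter_insert, if_neg (lt_irrefl _), Finset.filter_true_of_mem h3]
    · unfold ck
      rw [Finset.filter_false_of_mem]
      · simp
      · intro x hx
        have := hX hx
        simp only [Finset.mem_range] at this
        omega
  · apply Finset.prod_congr rfl
    intro y hy
    congr 1
    unfold rk
    rw [Finset.filter_insert, if_neg (by have := h3 y hy; omega)]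

theorem FF_zero_zero (n e : ℕ) : FF n 0 0 e = 1 := by simp [FF, GG]

theorem FF_zero (a b e : ℕ) (h : 0 < a + b) : FF 0 a b e = 0 := by
  unfold FF
  rcases Nat.eq_zero_or_pos a with rfl | ha
  · have hb : 0 < b := by omega
    rw [show (Finset.range 0).powersetCard b = ∅ from Finset.powersetCard_eq_empty.2 (by simpa using hb)]
    simp
  · rw [Finset.powersetCard_eq_empty.2 (by simpa using ha)]
    simp

/-- both positive -/
theorem FF_succ (n a b e : ℕ) : FF (n + 1) (a + 1) (b + 1) e = FF n (a + 1) (b + 1) e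
    + FF n a (b + 1) (e + 1) + ww b e * (FF n (a + 1) b e + FF n a b (e + 1)) := by
  unfold FF
  rw [sum_pc_succ]
  simp only [sum_pc_succ n b]
  rw [Finset.sum_add_distrib, Finset.sum_add_distrib]
  have e1 : ∑ X ∈ (Finset.range n).powersetCard (a + 1), ∑ Y ∈ (Finset.range n).powersetCard b,
      GG X (insert n Y) e = ww b e * ∑ X ∈ (Finset.range n).powersetCard (a + 1),
        ∑ Y ∈ (Finset.range n).powersetCard b, GG X Y e := by
    rw [Finset.mul_sum]
    refine Finset.sum_congr rfl fun X hX => ?_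
    rw [Finset.mul_sum]
    refine Finset.sum_congr rfl fun Y hY => ?_
    rw [Finset.mem_powersetCard] at hX hY
    rw [GG_insY n e X Y (hX.1.trans (Finset.range_subset_range.2 (Nat.le_succ n))) hY.1, hY.2]
  have e2 : ∑ X ∈ (Finset.range n).powersetCard a, ∑ Y ∈ (Finset.range n).powersetCard b,
      GG (insert n X) (insert n Y) e = ww b e * ∑ X ∈ (Finset.range n).powersetCard a,
        ∑ Y ∈ (Finset.range n).powersetCard b, GG X Y (e + 1) := by
    rw [Finset.mul_sum]
    refine Finset.sum_congr rfl fun X hX => ?_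
    rw [Finset.mul_sum]
    refine Finset.sum_congr rfl fun Y hY => ?_
    rw [Finset.mem_powersetCard] at hX hY
    rw [GG_insY n e _ Y _ hY.1, hY.2, GG_insX n e X Y hX.1 hY.1]
    rw [Finset.range_add_one]
    exact Finset.insert_subset_insert _ hX.1
  have e3 : ∑ X ∈ (Finset.range n).powersetCard a, ∑ Y ∈ (Finset.range n).powersetCard (b + 1),
      GG (insert n X) Y e = ∑ X ∈ (Finset.range n).powersetCard a,
        ∑ Y ∈ (Finset.range n).powersetCard (b + 1), GG X Y (e + 1) := by
    refine Finset.sum_congr rfl fun X hX => ?_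
    refine Finset.sum_congr rfl fun Y hY => ?_
    rw [Finset.mem_powersetCard] at hX hY
    rw [GG_insX n e X Y hX.1 hY.1]
  rw [e1, e2, e3]
  ring

theorem FF_a (n a e : ℕ) : FF n a 0 e = n.choose a := by
  simp [FF, GG]

theorem FF_b (n b e : ℕ) : FF (n + 1) 0 (b + 1) e = FF n 0 (b + 1) e + ww b e * FF n 0 b e := by
  unfold FF
  simp only [sum_pc_succ n b, Finset.powersetCard_zero, Finset.sum_singleton]
  congr 1
  rw [Finset.mul_sum]
  refine Finset.sum_congr rfl fun Y hY => ?_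
  rw [Finset.mem_powersetCard] at hY
  rw [GG_insY n e ∅ Y (by simp) hY.1, hY.2]

mutual
def VX (a b e : ℕ) (f : ℕ → ℚ) : ℚ :=
  match a with
  | 0 => 0
  | a + 1 => VX a b (e + 1) f + VY a b (e + 1) f
termination_by a + b
def VY (a b e : ℕ) (f : ℕ → ℚ) : ℚ :=
  match b with
  | 0 => if a = 0 then f 0 else 0
  | b + 1 => ww b e * (VY a b e f + VX a b e (fun d => f (d + 1)))
termination_by a + b
end

theorem VX_zero (b e : ℕ) (f : ℕ → ℚ) : VX 0 b e f = 0 := by rw [VX]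
theorem VX_succ (a b e : ℕ) (f : ℕ → ℚ) :
    VX (a + 1) b e f = VX a b (e + 1) f + VY a b (e + 1) f := by rw [VX]
theorem VY_zero (a e : ℕ) (f : ℕ → ℚ) : VY a 0 e f = if a = 0 then f 0 else 0 := by rw [VY]
theorem VY_succ (a b e : ℕ) (f : ℕ → ℚ) :
    VY a (b + 1) e f = ww b e * (VY a b e f + VX a b e (fun d => f (d + 1))) := by rw [VY]

theorem ind2 {P : ℕ → ℕ → Prop} (h0 : P 0 0) (hX : ∀ a, P a 0 → P (a + 1) 0)
    (hY : ∀ b, P 0 b → P 0 (b + 1)) (h : ∀ a b, P a (b + 1) → P (a + 1) b → P (a + 1) (b + 1)) :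
    ∀ a b, P a b := by
  intro a b
  induction b generalizing a with
  | zero =>
    induction a with
    | zero => exact h0
    | succ a ih => exact hX a ih
  | succ b ihb =>
    induction a with
    | zero => exact hY b (ihb 0)
    | succ a ih => exact h a b ih (ihb (a + 1))

theorem V_add (a b : ℕ) : (∀ e f g, VX a b e (fun d => f d + g d) = VX a b e f + VX a b e g) ∧
    (∀ e f g, VY a b e (fun d => f d + g d) = VY a b e f + VY a b e g) := by
  revert a b
  apply ind2
  · constructor <;> intros <;> simp [VX_zero, VY_zero]
  · rintro a ⟨h1, h2⟩
    constructor
    · intro e f g; simp only [VX_succ, h1, h2]; ring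
    · intro e f g; simp [VY_zero]
  · rintro b ⟨h1, h2⟩
    constructor
    · intro e f g; simp [VX_zero]
    · intro e f g
      simp only [VY_succ, h2, VX_zero]; ring
  · rintro a b ⟨h1, h2⟩ ⟨h3, h4⟩
    constructor
    · intro e f g; simp only [VX_succ a, h1, h2]; ring
    · intro e f g
      simp only [VY_succ _ b, h4]
      rw [h3 e (fun d => f (d + 1)) (fun d => g (d + 1))]; ring

theorem V_nonneg (a b : ℕ) : (∀ e f, (∀ d, 0 ≤ f d) → 0 ≤ VX a b e f) ∧
    (∀ e f, (∀ d, 0 ≤ f d) → 0 ≤ VY a b e f) := by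
  revert a b
  apply ind2
  · constructor
    · intro e f hf; simp [VX_zero]
    · intro e f hf; simp [VY_zero, hf]
  · rintro a ⟨h1, h2⟩
    constructor
    · intro e f hf; rw [VX_succ]; exact add_nonneg (h1 _ _ hf) (h2 _ _ hf)
    · intro e f hf; simp [VY_zero]
  · rintro b ⟨h1, h2⟩
    constructor
    · intro e f hf; simp [VX_zero]
    · intro e f hf
      rw [VY_succ]
      exact mul_nonneg (ww_nonneg _ _) (add_nonneg (h2 _ _ hf) (h1 _ _ fun d => hf _))
  · rintro a b ⟨h1, h2⟩ ⟨h3, h4⟩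
    constructor
    · intro e f hf; rw [VX_succ]; exact add_nonneg (h1 _ _ hf) (h2 _ _ hf)
    · intro e f hf
      rw [VY_succ]
      exact mul_nonneg (ww_nonneg _ _) (add_nonneg (h4 _ _ hf) (h3 _ _ fun d => hf _))

/-- the binomial test function -/
def bf (n s d : ℕ) : ℚ := (n + d).choose s

theorem bf_succ (n s d : ℕ) : bf (n + 1) (s + 1) d = bf n (s + 1) d + bf n s d := by
  unfold bf
  rw [show n + 1 + d = n + d + 1 by ring, Nat.choose_succ_succ']
  push_cast; ring

theorem bf_shift (n s : ℕ) : (fun d => bf n s (d + 1)) = bf (n + 1) s := by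
  funext d
  unfold bf
  rw [show n + (d + 1) = n + 1 + d by ring]

theorem bf_nonneg (n s d : ℕ) : 0 ≤ bf n s d := by unfold bf; positivity

theorem VX_a0 (a e : ℕ) (f : ℕ → ℚ) : VX (a + 1) 0 e f = f 0 := by
  induction a generalizing e with
  | zero => simp [VX_succ, VX_zero, VY_zero]
  | succ a ih => rw [VX_succ, ih, VY_zero]; simp

theorem V_bf_succ (n s a b e : ℕ) :
    VX a b e (bf (n + 1) (s + 1)) + VY a b e (bf (n + 1) (s + 1))
      = (VX a b e (bf n (s + 1)) + VY a b e (bf n (s + 1)))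
        + (VX a b e (bf n s) + VY a b e (bf n s)) := by
  have : bf (n + 1) (s + 1) = fun d => bf n (s + 1) d + bf n s d := by
    funext d; exact bf_succ n s d
  rw [this, (V_add a b).1, (V_add a b).2]; ring

theorem FF_le_V (n : ℕ) : ∀ a b e, FF n a b e ≤ VX a b e (bf n (a + b)) + VY a b e (bf n (a + b)) := by
  induction n with
  | zero =>
    intro a b e
    rcases Nat.eq_zero_or_pos (a + b) with h | h
    · have ha : a = 0 := by omega
      have hb : b = 0 := by omega
      subst ha hb
      simp [FF_zero_zero, VX_zero, VY_zero, bf]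
    · rw [FF_zero a b e h]
      exact add_nonneg ((V_nonneg a b).1 _ _ fun d => bf_nonneg _ _ _)
        ((V_nonneg a b).2 _ _ fun d => bf_nonneg _ _ _)
  | succ n ih =>
    intro a b e
    rcases a with _ | a
    · rcases b with _ | b
      · simp [FF_zero_zero, VX_zero, VY_zero, bf]
      · rw [FF_b, show 0 + (b + 1) = b + 1 by ring, V_bf_succ]
        have h1 := ih 0 (b + 1) e
        have h2 := ih 0 b e
        have h3 : ww b e * FF n 0 b e ≤ VX 0 (b + 1) e (bf n b) + VY 0 (b + 1) e (bf n b) := by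
          rw [VX_zero, VY_succ, VX_zero, zero_add, add_zero]
          apply mul_le_mul_of_nonneg_left _ (ww_nonneg _ _)
          rw [VX_zero, zero_add, zero_add] at h2
          exact h2
        rw [show 0 + (b + 1) = b + 1 by ring] at h1
        linarith
    · rcases b with _ | b
      · rw [FF_a, VX_a0, VY_zero]
        simp [bf]
      · rw [FF_succ, show a + 1 + (b + 1) = a + b + 1 + 1 by ring, V_bf_succ]
        have h1 := ih (a + 1) (b + 1) e
        have h2 := ih a (b + 1) (e + 1)
        have h3 := ih (a + 1) b e
        have h4 := ih a b (e + 1)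
        rw [show a + 1 + (b + 1) = a + b + 1 + 1 by ring] at h1
        rw [show a + (b + 1) = a + b + 1 by ring] at h2
        rw [show a + 1 + b = a + b + 1 by ring] at h3
        have h5 : VY (a + 1) (b + 1) e (bf n (a + b + 1)) = ww b e *
            ((VX (a + 1) b e (bf n (a + b + 1)) + VY (a + 1) b e (bf n (a + b + 1)))
              + (VX a b (e + 1) (bf n (a + b)) + VY a b (e + 1) (bf n (a + b)))) := by
          rw [VY_succ, bf_shift]
          have : bf (n + 1) (a + b + 1) = fun d => bf n (a + b + 1) d + bf n (a + b) d := by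
            funext d; exact bf_succ n _ d
          rw [this, (V_add (a + 1) b).1, VX_succ a b e (bf n (a + b))]
          ring
        have h6 := mul_le_mul_of_nonneg_left (add_le_add h3 h4) (ww_nonneg b e)
        rw [h5, VX_succ a (b + 1) e (bf n (a + b + 1))]
        linarith

mutual
def QX (ρ : ℚ) (a b e : ℕ) : ℚ :=
  match a with
  | 0 => 0
  | a + 1 => QX ρ a b (e + 1) + QY ρ a b (e + 1)
termination_by a + b
def QY (ρ : ℚ) (a b e : ℕ) : ℚ :=
  match b with
  | 0 => if a = 0 then 1 else 0
  | b + 1 => ww b e * (QY ρ a b e + ρ * QX ρ a b e)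
termination_by a + b
end

theorem QX_zero (ρ : ℚ) (b e : ℕ) : QX ρ 0 b e = 0 := by rw [QX]
theorem QX_succ (ρ : ℚ) (a b e : ℕ) :
    QX ρ (a + 1) b e = QX ρ a b (e + 1) + QY ρ a b (e + 1) := by rw [QX]
theorem QY_zero (ρ : ℚ) (a e : ℕ) : QY ρ a 0 e = if a = 0 then 1 else 0 := by rw [QY]
theorem QY_succ (ρ : ℚ) (a b e : ℕ) :
    QY ρ a (b + 1) e = ww b e * (QY ρ a b e + ρ * QX ρ a b e) := by rw [QY]

theorem V_le_Q (ρ : ℚ) (a b : ℕ) :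
    (∀ e f κ, (∀ d, 2 * d + 1 ≤ a + b → f d ≤ κ * ρ ^ d) → VX a b e f ≤ κ * QX ρ a b e) ∧
    (∀ e f κ, (∀ d, 2 * d ≤ a + b → f d ≤ κ * ρ ^ d) → VY a b e f ≤ κ * QY ρ a b e) := by
  revert a b
  apply ind2
  · constructor
    · intro e f κ hf; simp [VX_zero, QX_zero]
    · intro e f κ hf; have := hf 0; simpa [VY_zero, QY_zero] using this
  · rintro a ⟨h1, h2⟩
    constructor
    · intro e f κ hf
      rw [VX_succ, QX_succ, mul_add]
      exact add_le_add (h1 _ _ _ fun d hd => hf d (by omega)) (h2 _ _ _ fun d hd => hf d (by omega))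
    · intro e f κ hf; simp [VY_zero, QY_zero]
  · rintro b ⟨h1, h2⟩
    constructor
    · intro e f κ hf; simp [VX_zero, QX_zero]
    · intro e f κ hf
      rw [VY_succ, QY_succ, VX_zero, QX_zero, mul_left_comm, mul_zero]
      apply mul_le_mul_of_nonneg_left _ (ww_nonneg _ _)
      have := h2 e f κ fun d hd => hf d (by omega)
      linarith
  · rintro a b ⟨h1, h2⟩ ⟨h3, h4⟩
    constructor
    · intro e f κ hf
      rw [VX_succ, QX_succ, mul_add]
      exact add_le_add (h1 _ _ _ fun d hd => hf d (by omega)) (h2 _ _ _ fun d hd => hf d (by omega))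
    · intro e f κ hf
      rw [VY_succ, QY_succ, mul_left_comm]
      apply mul_le_mul_of_nonneg_left _ (ww_nonneg _ _)
      have e1 := h4 e f κ fun d hd => hf d (by omega)
      have e2 := h3 e (fun d => f (d + 1)) (κ * ρ) fun d hd => by
        have := hf (d + 1) (by omega)
        rw [pow_succ] at this
        calc _ ≤ _ := this
          _ = _ := by ring
      calc _ ≤ _ := add_le_add e1 e2
        _ = _ := by ring

theorem Ex2_le (k T : ℕ) (κ ρ : ℚ)
    (h : ∀ d, 2 * d ≤ T → ((k + 1 + d).choose T : ℚ) ≤ κ * ρ ^ d) :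
    Ex k (2 * (k + 1)) T ≤ κ * ∑ t ∈ Finset.range (T + 1),
      UU t * UU (T - t) * (QX ρ t (T - t) 0 + QY ρ t (T - t) 0) := by
  rw [Ex2_eq, Finset.mul_sum]
  apply Finset.sum_le_sum
  intro t ht
  simp only [Finset.mem_range] at ht
  have hs : t + (T - t) = T := by omega
  rw [mul_left_comm]
  apply mul_le_mul_of_nonneg_left _ (mul_nonneg (UU_nonneg _) (UU_nonneg _))
  refine (FF_le_V _ _ _ _).trans ?_
  rw [mul_add, hs]
  exact add_le_add ((V_le_Q ρ t (T - t)).1 _ _ _ fun d hd => h d (by omega))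
    ((V_le_Q ρ t (T - t)).2 _ _ _ fun d hd => h d (by omega))


/-! ### Part 5: the numerical regime -/

theorem ww_le (r c : ℕ) : ww r c ≤ (1 + c) / 2 ^ c := by
  unfold ww
  have h : (0 : ℚ) < 2 ^ c := by positivity
  have hr : (0 : ℚ) < (r : ℚ) + 1 := by positivity
  rw [div_le_div_iff₀ (by positivity) h]
  have : ((r : ℚ) + 1 + c) ≤ (1 + c) * (r + 1) := by
    have : (0 : ℚ) ≤ (r : ℚ) * c := by positivity
    linarith
  nlinarith

theorem Q_nonneg (ρ : ℚ) (hρ : 0 ≤ ρ) (a b : ℕ) :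
    (∀ e, 0 ≤ QX ρ a b e) ∧ (∀ e, 0 ≤ QY ρ a b e) := by
  revert a b
  apply ind2
  · simp [QX_zero, QY_zero]
  · rintro a ⟨h1, h2⟩
    exact ⟨fun e => by rw [QX_succ]; exact add_nonneg (h1 _) (h2 _), fun e => by simp [QY_zero]⟩
  · rintro b ⟨h1, h2⟩
    refine ⟨fun e => by simp [QX_zero], fun e => ?_⟩
    rw [QY_succ]
    exact mul_nonneg (ww_nonneg _ _) (add_nonneg (h2 _) (mul_nonneg hρ (h1 _)))
  · rintro a b ⟨h1, h2⟩ ⟨h3, h4⟩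
    refine ⟨fun e => by rw [QX_succ]; exact add_nonneg (h1 _) (h2 _), fun e => ?_⟩
    rw [QY_succ]
    exact mul_nonneg (ww_nonneg _ _) (add_nonneg (h4 _) (mul_nonneg hρ (h3 _)))

theorem Q_b0 (ρ : ℚ) (a e : ℕ) : QX ρ a 0 e + QY ρ a 0 e = 1 := by
  induction a generalizing e with
  | zero => simp [QX_zero, QY_zero]
  | succ a ih => rw [QX_succ, ih, QY_zero]; simp

theorem Q_b0' (ρ : ℚ) (hρ : 1 ≤ ρ) (a e : ℕ) : QY ρ a 0 e + ρ * QX ρ a 0 e ≤ ρ := by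
  have h1 := Q_b0 ρ a e
  have h2 := (Q_nonneg ρ (by linarith) a 0).2 e
  have h3 := (Q_nonneg ρ (by linarith) a 0).1 e
  nlinarith

theorem Q_tail (ρ : ℚ) (hρ : 1 ≤ ρ) (a b : ℕ) : ∀ e : ℕ, ((e : ℚ) + 3) * (ρ + 1) ≤ 2 ^ e →
    (QX ρ a (b + 1) e ≤ ρ * (e + 3) / 2 ^ e) ∧ (QY ρ a (b + 1) e ≤ ρ * (1 + e) / 2 ^ e) := by
  have key : ∀ a b e, QY ρ a b e + ρ * QX ρ a b e ≤ ρ → QY ρ a (b + 1) e ≤ ρ * (1 + e) / 2 ^ e := by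
    intro a b e h
    rw [QY_succ]
    calc _ ≤ ww b e * ρ := mul_le_mul_of_nonneg_left h (ww_nonneg _ _)
      _ ≤ (1 + e) / 2 ^ e * ρ := mul_le_mul_of_nonneg_right (ww_le _ _) (by linarith)
      _ = _ := by ring
  have keyX : ∀ a b e, (QX ρ a (b + 1) (e + 1) ≤ ρ * ((e + 1 : ℕ) + 3) / 2 ^ (e + 1)) →
      (QY ρ a (b + 1) (e + 1) ≤ ρ * (1 + (e + 1 : ℕ)) / 2 ^ (e + 1)) →
      QX ρ (a + 1) (b + 1) e ≤ ρ * (e + 3) / 2 ^ e := by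
    intro a b e h1 h2
    rw [QX_succ]
    calc _ ≤ _ := add_le_add h1 h2
      _ = _ := by push_cast; rw [pow_succ]; field_simp; ring
  have hstep : ∀ e : ℕ, ((e : ℚ) + 3) * (ρ + 1) ≤ 2 ^ e →
      (((e + 1 : ℕ) : ℚ) + 3) * (ρ + 1) ≤ 2 ^ (e + 1) := by
    intro e h
    rw [pow_succ]
    push_cast
    have : (0 : ℚ) ≤ e := by positivity
    nlinarith
  have comb : ∀ (e : ℕ) (x y : ℚ), ((e : ℚ) + 3) * (ρ + 1) ≤ 2 ^ e → x ≤ ρ * (e + 3) / 2 ^ e →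
      y ≤ ρ * (1 + e) / 2 ^ e → y + ρ * x ≤ ρ := by
    intro e x y he hx hy
    have hp : (0 : ℚ) < 2 ^ e := by positivity
    have h1 : y + ρ * x ≤ ρ * (1 + e) / 2 ^ e + ρ * (ρ * (e + 3) / 2 ^ e) :=
      add_le_add hy (mul_le_mul_of_nonneg_left hx (by linarith))
    refine h1.trans ?_
    have : ρ * (1 + e) / 2 ^ e + ρ * (ρ * (e + 3) / 2 ^ e)
        = ρ * (((1 + e) + ρ * (e + 3)) / 2 ^ e) := by ring
    rw [this]
    have h2 : ((1 + (e : ℚ)) + ρ * (e + 3)) / 2 ^ e ≤ 1 := by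
      rw [div_le_one hp]; linarith
    nlinarith
  induction b generalizing a with
  | zero =>
    induction a with
    | zero =>
      intro e he
      refine ⟨by rw [QX_zero]; positivity, key _ _ _ (Q_b0' ρ hρ _ _)⟩
    | succ a ih =>
      intro e he
      have := ih (e + 1) (hstep e he)
      exact ⟨keyX _ _ _ this.1 this.2, key _ _ _ (Q_b0' ρ hρ _ _)⟩
  | succ b ihb =>
    induction a with
    | zero =>
      intro e he
      refine ⟨by rw [QX_zero]; positivity, key _ _ _ ?_⟩
      exact comb e _ _ he (ihb 0 e he).1 (ihb 0 e he).2
    | succ a ih =>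
      intro e he
      have := ih (e + 1) (hstep e he)
      refine ⟨keyX _ _ _ this.1 this.2, key _ _ _ ?_⟩
      exact comb e _ _ he (ihb (a + 1) e he).1 (ihb (a + 1) e he).2

def strict {α : Type} (n : ℕ) (f : ℕ → α) : α :=
  match n with
  | 0 => f 0
  | n + 1 => f (n + 1)

theorem strict_eq {α : Type} (n : ℕ) (f : ℕ → α) : strict n f = f n := by
  cases n <;> rfl

def stepRow (b rn rd : ℕ) : ℕ → ℕ → List (ℕ × ℕ) → List (ℕ × ℕ)
  | acc, e + 1, p :: l =>
    strict ((b + 1 + e) * (rd * p.2 + rn * p.1) / ((b + 1) * 2 ^ e * rd) + 1) fun ny =>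
      (acc, ny) :: strict (acc + ny) fun acc' => stepRow b rn rd acc' e l
  | _, _, _ => []

def lastSum : List (ℕ × ℕ) → ℕ
  | [] => 0
  | [p] => p.1 + p.2
  | _ :: q :: l => lastSum (q :: l)

/-- `goRows fuel b row tab` -/
def goRows (E rn rd δ : ℕ) : ℕ → ℕ → List (ℕ × ℕ) → List ℕ → List ℕ
  | 0, _, _, tab => tab
  | fuel + 1, b, row, tab =>
    strict (lastSum (stepRow b rn rd δ E row)) fun r =>
      goRows E rn rd δ fuel (b + 1) (stepRow b rn rd δ E row) (r :: tab)

def tabl (T E rn rd S : ℕ) : List ℕ :=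
  goRows E rn rd (S * rn * (E + 2) / (rd * 2 ^ (E - 1)) + 1) T 0 (List.replicate E (S, 0)) [S]

def kapF (n T rn rd KS : ℕ) : ℕ → ℕ
  | 0 => Nat.descFactorial n T * KS
  | d + 1 => max (kapF n T rn rd KS d)
      (Nat.descFactorial (n + (d + 1)) T * rd ^ (d + 1) * KS / rn ^ (d + 1) + 1)

def numSum (T : ℕ) : ℕ → List ℕ → ℕ
  | _, [] => 0
  | t, r :: l => t.factorial * (T - t).factorial * 2 ^ (t * (T - t)) * r + numSum T (t + 1) l

def numCheck (m E rn rd S KS : ℕ) : Bool :=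
  Nat.blt (numSum (4 * m - 1) 0 (tabl (4 * m - 1) E rn rd S) *
    kapF (2 ^ m) (4 * m - 1) rn rd KS ((4 * m - 1) / 2))
    ((4 * m - 1).factorial * 2 ^ ((4 * m - 1) * (4 * m - 2) / 2) * S * KS)

def AllRow (P : ℕ → ℕ × ℕ → Prop) : ℕ → List (ℕ × ℕ) → Prop
  | 0, [] => True
  | e + 1, p :: l => P e p ∧ AllRow P e l
  | _, _ => False

/-- weak and strong correctness of an entry -/
def WeakP (ρ : ℚ) (S b : ℕ) (e : ℕ) (p : ℕ × ℕ) : Prop :=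
  ∀ a, S * (QY ρ a b e + ρ * QX ρ a b e) ≤ p.2 + ρ * p.1
def StrongP (ρ : ℚ) (S b : ℕ) (e : ℕ) (p : ℕ × ℕ) : Prop :=
  ∀ a, S * QX ρ a b e ≤ p.1 ∧ S * QY ρ a b e ≤ p.2

theorem AllRow.imp {P R : ℕ → ℕ × ℕ → Prop} (h : ∀ e p, P e p → R e p) :
    ∀ e l, AllRow P e l → AllRow R e l
  | 0, [], _ => trivial
  | e + 1, _ :: l, hh => ⟨h _ _ hh.1, AllRow.imp h e l hh.2⟩
  | 0, _ :: _, hh => hh.elim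
  | _ + 1, [], hh => hh.elim

theorem strong_weak (ρ : ℚ) (hρ : 0 ≤ ρ) (S b e : ℕ) (p : ℕ × ℕ) (h : StrongP ρ S b e p) :
    WeakP ρ S b e p := by
  intro a
  have := h a
  nlinarith [mul_le_mul_of_nonneg_left this.1 hρ]

theorem div_succ_ge (x y : ℕ) (hy : 0 < y) : (x : ℚ) / y ≤ ((x / y + 1 : ℕ) : ℚ) := by
  rw [div_le_iff₀ (by exact_mod_cast hy)]
  have : x ≤ (x / y + 1) * y := by
    have := Nat.div_add_mod x y
    have := Nat.mod_lt x hy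
    nlinarith
  exact_mod_cast this

theorem stepRow_ok (rn rd S b : ℕ) (hrd : 0 < rd) :
    ∀ (e : ℕ) (l : List (ℕ × ℕ)) (acc : ℕ), AllRow (WeakP ((rn : ℚ) / rd) S b) e l →
      (∀ a e', e = e' + 1 → S * QX ((rn : ℚ) / rd) a (b + 1) e' ≤ acc) →
      AllRow (StrongP ((rn : ℚ) / rd) S (b + 1)) e (stepRow b rn rd acc e l)
  | 0, [], acc, _, _ => by simp [stepRow, AllRow]
  | 0, _ :: _, _, h, _ => h.elim
  | _ + 1, [], _, h, _ => h.elim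
  | e + 1, p :: l, acc, h, hacc => by
    rw [stepRow, strict_eq, strict_eq]
    set ny := (b + 1 + e) * (rd * p.2 + rn * p.1) / ((b + 1) * 2 ^ e * rd) + 1 with hny
    have hY : ∀ a, S * QY ((rn : ℚ) / rd) a (b + 1) e ≤ ny := by
      intro a
      have h1 := h.1 a
      have h2 := div_succ_ge ((b + 1 + e) * (rd * p.2 + rn * p.1)) ((b + 1) * 2 ^ e * rd)
        (by positivity)
      rw [← hny] at h2
      refine le_trans ?_ h2
      rw [QY_succ, mul_left_comm]
      refine (mul_le_mul_of_nonneg_left h1 (ww_nonneg b e)).trans (le_of_eq ?_)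
      unfold ww
      have : (rd : ℚ) ≠ 0 := by positivity
      push_cast
      field_simp
    refine ⟨fun a => ⟨hacc a e rfl, hY a⟩, ?_⟩
    apply stepRow_ok rn rd S b hrd e l _ h.2
    rintro a e' rfl
    rcases a with _ | a
    · rw [QX_zero, mul_zero]; positivity
    · rw [QX_succ, mul_add]
      push_cast
      exact add_le_add (hacc a _ rfl) (hY a)

theorem lastSum_ok (ρ : ℚ) (S b : ℕ) : ∀ (e : ℕ) (l : List (ℕ × ℕ)),
    AllRow (StrongP ρ S b) (e + 1) l → ∀ a, S * (QX ρ a b 0 + QY ρ a b 0) ≤ lastSum l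
  | 0, [p], h, a => by
    have := h.1 a
    rw [lastSum]; push_cast; linarith
  | _, [], h, _ => h.elim
  | 0, _ :: _ :: _, h, _ => h.2.elim
  | _ + 1, [_], h, _ => h.2.elim
  | e + 1, _ :: q :: l, h, a => by
    rw [lastSum]
    exact lastSum_ok ρ S b e (q :: l) h.2 a

/-- table correctness: entry `i` bounds the value for `b - i` -/
def TabOK (ρ : ℚ) (S : ℕ) : ℕ → List ℕ → Prop
  | 0, [r] => ∀ a, S * (QX ρ a 0 0 + QY ρ a 0 0) ≤ r
  | b + 1, r :: l => (∀ a, S * (QX ρ a (b + 1) 0 + QY ρ a (b + 1) 0) ≤ r) ∧ TabOK ρ S b l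
  | _, _ => False

theorem goRows_ok (E rn rd S δ : ℕ) (hrd : 0 < rd)
    (hδ : ∀ a b, S * QX ((rn : ℚ) / rd) a (b + 1) E ≤ δ) :
    ∀ (fuel b : ℕ) (row : List (ℕ × ℕ)) (tab : List ℕ),
      AllRow (WeakP ((rn : ℚ) / rd) S b) (E + 1) row → TabOK ((rn : ℚ) / rd) S b tab →
      TabOK ((rn : ℚ) / rd) S (b + fuel) (goRows (E + 1) rn rd δ fuel b row tab) := by
  intro fuel
  induction fuel with
  | zero => intro b row tab _ h; exact h
  | succ fuel ih =>
    intro b row tab h1 h2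
    rw [goRows, strict_eq, show b + (fuel + 1) = b + 1 + fuel by ring]
    have h3 := stepRow_ok rn rd S b hrd (E + 1) row δ h1 (by
      intro a e' he'
      have : e' = E := by omega
      rw [this]; exact hδ a b)
    apply ih
    · exact h3.imp (fun e p => strong_weak _ (by positivity) S (b + 1) e p)
    · exact ⟨lastSum_ok _ S (b + 1) E _ h3, h2⟩

theorem tabl_ok (T E rn rd S : ℕ) (hrd : 0 < rd) (hr : rd ≤ rn)
    (hE : (E + 3) * (rn + rd) ≤ rd * 2 ^ E) :
    TabOK ((rn : ℚ) / rd) S T (tabl T (E + 1) rn rd S) := by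
  have hrd' : (0 : ℚ) < rd := by exact_mod_cast hrd
  have hρ : 1 ≤ (rn : ℚ) / rd := by
    rw [le_div_iff₀ hrd']; simpa using (by exact_mod_cast hr : (rd : ℚ) ≤ rn)
  unfold tabl
  have h0 : AllRow (WeakP ((rn : ℚ) / rd) S 0) (E + 1) (List.replicate (E + 1) (S, 0)) := by
    generalize E + 1 = F
    induction F with
    | zero => trivial
    | succ F ih =>
      refine ⟨fun a => ?_, ih⟩
      have := mul_le_mul_of_nonneg_left (Q_b0' _ hρ a F) (by positivity : (0 : ℚ) ≤ S)
      simp only [Nat.cast_zero, zero_add]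
      linarith
  have hmain := goRows_ok E rn rd S (S * rn * (E + 1 + 2) / (rd * 2 ^ (E + 1 - 1)) + 1) hrd ?_ T 0 _ [S] h0 ?_
  · rw [Nat.zero_add] at hmain
    exact hmain
  · intro a b
    have h1 := (Q_tail _ hρ a b E (by
      have : ((E + 3 : ℚ)) * (rn + rd) ≤ rd * 2 ^ E := by exact_mod_cast hE
      have e : ((E : ℚ) + 3) * ((rn : ℚ) / rd + 1) = ((E + 3 : ℚ)) * (rn + rd) / rd := by
        field_simp
      rw [e, div_le_iff₀ hrd']; linarith)).1
    have h2 := div_succ_ge (S * rn * (E + 1 + 2)) (rd * 2 ^ (E + 1 - 1)) (by positivity)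
    refine le_trans ?_ h2
    refine (mul_le_mul_of_nonneg_left h1 (by positivity)).trans (le_of_eq ?_)
    rw [Nat.add_sub_cancel]
    push_cast
    field_simp
    ring
  · intro a
    rw [Q_b0, mul_one]

theorem kapF_ok (n T rn rd KS : ℕ) (hrn : 0 < rn) : ∀ D d, d ≤ D →
    Nat.descFactorial (n + d) T * rd ^ d * KS ≤ kapF n T rn rd KS D * rn ^ d := by
  intro D
  induction D with
  | zero =>
    intro d hd
    have : d = 0 := by omega
    subst this
    simp [kapF]
  | succ D ih =>
    intro d hd
    rcases Nat.lt_or_ge d (D + 1) with h | h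
    · refine (ih d (by omega)).trans ?_
      rw [kapF]
      exact Nat.mul_le_mul_right _ (le_max_left _ _)
    · have : d = D + 1 := by omega
      subst this
      rw [kapF]
      refine le_trans ?_ (Nat.mul_le_mul_right _ (le_max_right _ _))
      have h1 := Nat.div_add_mod (Nat.descFactorial (n + (D + 1)) T * rd ^ (D + 1) * KS)
        (rn ^ (D + 1))
      have h2 := Nat.mod_lt (Nat.descFactorial (n + (D + 1)) T * rd ^ (D + 1) * KS)
        (show 0 < rn ^ (D + 1) by positivity)
      nlinarith

theorem numSum_ok (ρ : ℚ) (S T : ℕ) : ∀ (b t : ℕ) (l : List ℕ), t + b = T → TabOK ρ S b l →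
    S * ∑ i ∈ Finset.range (b + 1), ((t + i).factorial : ℚ) * (T - (t + i)).factorial *
      2 ^ ((t + i) * (T - (t + i))) * (QX ρ (t + i) (T - (t + i)) 0 + QY ρ (t + i) (T - (t + i)) 0)
      ≤ numSum T t l
  | 0, t, [r], ht, h => by
    have hT : T - t = 0 := by omega
    have := h t
    have h2 : (0 : ℚ) ≤ t.factorial := by positivity
    simp only [zero_add, Finset.range_one, Finset.sum_singleton, add_zero, hT, numSum]
    push_cast
    simp only [Nat.factorial_zero, Nat.cast_one, mul_zero, pow_zero, mul_one]
    nlinarith [mul_le_mul_of_nonneg_left this h2]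
  | b + 1, t, r :: l, ht, h => by
    have ih := numSum_ok ρ S T b (t + 1) l (by omega) h.2
    rw [Finset.sum_range_succ', mul_add, numSum]
    push_cast
    rw [add_comm]
    apply add_le_add
    · have hT : T - t = b + 1 := by omega
      have := h.1 t
      simp only [add_zero, hT]
      have h2 : (0 : ℚ) ≤ t.factorial * (b + 1).factorial * 2 ^ (t * (b + 1)) := by positivity
      have h3 := mul_le_mul_of_nonneg_left this h2
      linarith
    · refine le_trans (le_of_eq ?_) ih
      congr 1
      apply Finset.sum_congr rfl
      intro i _
      rw [show t + (i + 1) = t + 1 + i by ring]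
  | 0, _, [], _, h => h.elim
  | 0, _, _ :: _ :: _, _, h => h.elim
  | _ + 1, _, [], _, h => h.elim

theorem add_choose2 (t b : ℕ) : (t + b).choose 2 = t.choose 2 + b.choose 2 + t * b := by
  induction b with
  | zero => simp
  | succ b ih =>
    rw [← add_assoc, Nat.choose_succ_succ' (t + b) 1, Nat.choose_succ_succ' b 1, ih,
      Nat.choose_one_right, Nat.choose_one_right]
    ring

theorem UU_mul (T t : ℕ) (ht : t ≤ T) :
    UU t * UU (T - t) * 2 ^ (T.choose 2) = t.factorial * (T - t).factorial * 2 ^ (t * (T - t)) := by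
  obtain ⟨b, rfl⟩ := Nat.exists_eq_add_of_le ht
  rw [Nat.add_sub_cancel_left, ← UU_eq, ← UU_eq, add_choose2, pow_add, pow_add]
  ring

theorem Ex2_scaled (k T : ℕ) (κ ρ : ℚ)
    (h : ∀ d, 2 * d ≤ T → ((k + 1 + d).descFactorial T : ℚ) ≤ κ * ρ ^ d) :
    Ex k (2 * (k + 1)) T * (T.factorial * 2 ^ (T.choose 2)) ≤ κ * ∑ t ∈ Finset.range (T + 1),
      (t.factorial : ℚ) * (T - t).factorial * 2 ^ (t * (T - t)) *
        (QX ρ t (T - t) 0 + QY ρ t (T - t) 0) := by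
  have hf : (0 : ℚ) < T.factorial := by positivity
  have h1 := Ex2_le k T (κ / T.factorial) ρ (fun d hd => by
    have := h d hd
    rw [Nat.descFactorial_eq_factorial_mul_choose] at this
    push_cast at this
    rw [div_mul_eq_mul_div, le_div_iff₀ hf]
    linarith)
  have h2 := mul_le_mul_of_nonneg_right h1
    (by positivity : (0 : ℚ) ≤ T.factorial * 2 ^ (T.choose 2))
  refine h2.trans (le_of_eq ?_)
  have e : ∀ s : ℚ, κ / T.factorial * s * (T.factorial * 2 ^ (T.choose 2))
      = κ * (s * 2 ^ (T.choose 2)) := by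
    intro s; field_simp
  rw [e, Finset.sum_mul]
  congr 1
  apply Finset.sum_congr rfl
  intro t ht
  simp only [Finset.mem_range] at ht
  rw [← UU_mul T t (by omega)]
  ring

theorem num_main (k m E rn rd S KS : ℕ) (hk : k + 1 ≤ 2 ^ m) (hrd : 0 < rd) (hr : rd ≤ rn)
    (hE : (E + 3) * (rn + rd) ≤ rd * 2 ^ E) (hS : 0 < S) (hKS : 0 < KS)
    (hc : numCheck m (E + 1) rn rd S KS = true) : Ex k (2 * (k + 1)) (4 * m - 1) < 1 := by
  have hc1 : numSum (4 * m - 1) 0 (tabl (4 * m - 1) (E + 1) rn rd S) *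
    kapF (2 ^ m) (4 * m - 1) rn rd KS ((4 * m - 1) / 2) <
    ((4 * m - 1).factorial * 2 ^ ((4 * m - 1) * (4 * m - 2) / 2) * S * KS) := by
    unfold numCheck at hc
    simpa [Nat.blt] using hc
  rw [show 4 * m - 2 = 4 * m - 1 - 1 by omega, ← Nat.choose_two_right] at hc1
  generalize 4 * m - 1 = T at hc1 ⊢
  have hrd' : (0 : ℚ) < rd := by exact_mod_cast hrd
  have hrn' : (0 : ℚ) < rn := by exact_mod_cast (lt_of_lt_of_le hrd hr)
  have hS' : (0 : ℚ) < S := by exact_mod_cast hS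
  have hKS' : (0 : ℚ) < KS := by exact_mod_cast hKS
  have ht := numSum_ok ((rn : ℚ) / rd) S T T 0 _ (by omega) (tabl_ok T E rn rd S hrd hr hE)
  simp only [zero_add] at ht
  have hsc := Ex2_scaled k T (kapF (2 ^ m) T rn rd KS (T / 2) / KS) ((rn : ℚ) / rd) (fun d hd => by
    have h1 := kapF_ok (2 ^ m) T rn rd KS (by omega) (T / 2) d (by omega)
    have h2 : (k + 1 + d).descFactorial T ≤ (2 ^ m + d).descFactorial T :=
      Nat.descFactorial_le _ (by omega)
    have h3 : ((k + 1 + d).descFactorial T : ℚ) * rd ^ d * KS ≤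
        kapF (2 ^ m) T rn rd KS (T / 2) * rn ^ d := by
      exact_mod_cast (Nat.mul_le_mul_right _ (Nat.mul_le_mul_right _ h2)).trans h1
    rw [div_pow, div_mul_div_comm, le_div_iff₀ (by positivity)]
    linarith)
  generalize numSum T 0 (tabl T (E + 1) rn rd S) = A at *
  generalize kapF (2 ^ m) T rn rd KS (T / 2) = B at *
  generalize hZ : ∑ t ∈ Finset.range (T + 1), (t.factorial : ℚ) * (T - t).factorial *
    2 ^ (t * (T - t)) * (QX ((rn : ℚ) / rd) t (T - t) 0 + QY ((rn : ℚ) / rd) t (T - t) 0) = Z at *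
  have hc2 : (A : ℚ) * B < T.factorial * 2 ^ (T.choose 2) * S * KS := by exact_mod_cast hc1
  have hF : (0 : ℚ) < T.factorial * 2 ^ (T.choose 2) := by positivity
  generalize (T.factorial : ℚ) * 2 ^ (T.choose 2) = F at *
  have h4 : Ex k (2 * (k + 1)) T * F * (S * KS) < F * (S * KS) := by
    calc Ex k (2 * (k + 1)) T * F * (S * KS) ≤ (B / KS * Z) * (S * KS) :=
          mul_le_mul_of_nonneg_right hsc (by positivity)
      _ = B * (S * Z) := by field_simp
      _ ≤ B * A := mul_le_mul_of_nonneg_left ht (by positivity)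
      _ < F * (S * KS) := by linarith
  have h5 : Ex k (2 * (k + 1)) T * (F * (S * KS)) < 1 * (F * (S * KS)) := by linarith
  exact lt_of_mul_lt_mul_right h5 (by positivity)

set_option maxRecDepth 100000 in
theorem Ex2_mid (k m : ℕ) (h3 : 3 ≤ m) (h20 : m ≤ 20) (hk : k + 1 ≤ 2 ^ m) :
    Ex k (2 * (k + 1)) (4 * m - 1) < 1 := by
  have hlow : ∀ rn, 8 ≤ rn → rn ≤ 64 → numCheck m (23 + 1) rn 8 (2 ^ 40) (2 ^ 40) = true →
      Ex k (2 * (k + 1)) (4 * m - 1) < 1 := by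
    intro rn h8 h64 hc
    exact num_main k m 23 rn 8 (2 ^ 40) (2 ^ 40) hk (by norm_num) h8
      (by norm_num; omega) (by positivity) (by positivity) hc
  interval_cases m
  · exact hlow 64 (by norm_num) (by norm_num) (by decide +kernel)
  · exact hlow 32 (by norm_num) (by norm_num) (by decide +kernel)
  · exact hlow 16 (by norm_num) (by norm_num) (by decide +kernel)
  · exact hlow 12 (by norm_num) (by norm_num) (by decide +kernel)
  · exact hlow 10 (by norm_num) (by norm_num) (by decide +kernel)
  · exact hlow 9 (by norm_num) (by norm_num) (by decide +kernel)
  · exact hlow 9 (by norm_num) (by norm_num) (by decide +kernel)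
  · exact hlow 9 (by norm_num) (by norm_num) (by decide +kernel)
  · exact hlow 9 (by norm_num) (by norm_num) (by decide +kernel)
  all_goals exact hlow 8 (by norm_num) (by norm_num) (by decide +kernel)


/-! ### Part 6: the smallest case and the asymptotic regime -/

def Fc : ℕ → ℕ → ℕ → ℕ → ℚ
  | 0, a, b, _ => if a + b = 0 then 1 else 0
  | n + 1, a, b, e =>
    match a, b with
    | 0, 0 => 1
    | a + 1, 0 => (n + 1).choose (a + 1)
    | 0, b + 1 => Fc n 0 (b + 1) e + ww b e * Fc n 0 b e
    | a + 1, b + 1 => Fc n (a + 1) (b + 1) e + Fc n a (b + 1) (e + 1)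
        + ww b e * (Fc n (a + 1) b e + Fc n a b (e + 1))

theorem FF_eq_Fc (n : ℕ) : ∀ a b e, FF n a b e = Fc n a b e := by
  induction n with
  | zero =>
    intro a b e
    rw [Fc]
    split_ifs with h
    · have ha : a = 0 := by omega
      have hb : b = 0 := by omega
      subst ha hb
      exact FF_zero_zero _ _
    · exact FF_zero _ _ _ (by omega)
  | succ n ih =>
    intro a b e
    rcases a with _ | a <;> rcases b with _ | b
    · simp [Fc, FF_zero_zero]
    · simp [Fc, FF_b, ih]
    · simp [Fc, FF_a]
    · simp [Fc, FF_succ, ih]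

def UUc : ℕ → ℚ
  | 0 => 1
  | t + 1 => UUc t * uw t

theorem UU_eq_UUc (t : ℕ) : UU t = UUc t := by
  induction t with
  | zero => simp [UU, UUc]
  | succ t ih => rw [UU_succ, ih, UUc]

def sumc (n T : ℕ) : ℕ → ℚ
  | 0 => 0
  | t + 1 => sumc n T t + UUc t * UUc (T - t) * Fc n t (T - t) 0

theorem sumc_eq (n T t : ℕ) :
    ∑ i ∈ Finset.range t, UU i * UU (T - i) * FF n i (T - i) 0 = sumc n T t := by
  induction t with
  | zero => simp [sumc]
  | succ t ih => rw [Finset.sum_range_succ, ih, sumc, FF_eq_Fc, UU_eq_UUc, UU_eq_UUc]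

set_option maxRecDepth 100000 in
theorem Ex2_two (k : ℕ) (hk : k + 1 ≤ 4) : Ex k (2 * (k + 1)) 7 < 1 := by
  rw [Ex2_eq, sumc_eq]
  have : k ≤ 3 := by omega
  interval_cases k <;> decide +kernel

theorem desc_pair (q d : ℕ) : Nat.descFactorial (q + d) (2 * d + 1) ≤ q ^ (2 * d + 1) := by
  induction d with
  | zero => simp
  | succ d ih =>
    rw [show q + (d + 1) = (q + d) + 1 by ring, show 2 * (d + 1) + 1 = (2 * d + 1 + 1) + 1 by ring,
      Nat.succ_descFactorial_succ, Nat.descFactorial_succ]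
    have h1 : (q + d + 1) * (q + d - (2 * d + 1)) ≤ q * q := by
      rcases Nat.lt_or_ge q (d + 1) with h | h
      · rw [show q + d - (2 * d + 1) = 0 by omega]; simp
      · obtain ⟨r, rfl⟩ := Nat.exists_eq_add_of_le h
        rw [show d + 1 + r + d - (2 * d + 1) = r by omega]
        nlinarith
    calc _ = ((q + d + 1) * (q + d - (2 * d + 1))) * (q + d).descFactorial (2 * d + 1) := by ring
      _ ≤ (q * q) * q ^ (2 * d + 1) := Nat.mul_le_mul h1 ih
      _ = _ := by ring

theorem desc_all (q d s : ℕ) :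
    Nat.descFactorial (q + d) (2 * d + 1 + s) ≤ q ^ (2 * d + 1 + s) := by
  induction s with
  | zero => exact desc_pair q d
  | succ s ih =>
    rw [← add_assoc, Nat.descFactorial_succ, pow_succ, mul_comm]
    exact Nat.mul_le_mul ih (by omega)

theorem QX_le_of (e : ℕ) (K : ℚ) (hK : 0 ≤ K) (h : ∀ a b, QX 1 a b (e + 1) + QY 1 a b (e + 1) ≤ K)
    (a b : ℕ) : QX 1 a b e ≤ K := by
  rcases a with _ | a
  · rw [QX_zero]; exact hK
  · rw [QX_succ]; exact h a b

theorem QY_b0_le (a e : ℕ) : QY 1 a 0 e ≤ 1 := by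
  rw [QY_zero]; split_ifs <;> norm_num

theorem QY_le_of (e : ℕ) (K M ω : ℚ) (hM : 1 ≤ M) (hX : ∀ a b, QX 1 a b e ≤ K)
    (h0 : ∀ a, QY 1 a 1 e ≤ M)
    (hω : ∀ b, ww (b + 1) e ≤ ω) (hc : ω * (M + K) ≤ M) (a b : ℕ) : QY 1 a b e ≤ M := by
  induction b with
  | zero => exact (QY_b0_le a e).trans hM
  | succ b ih =>
    rcases b with _ | b
    · exact h0 a
    · rw [QY_succ, one_mul]
      have n1 := (Q_nonneg 1 (by norm_num) a (b + 1)).1 e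
      have n2 := (Q_nonneg 1 (by norm_num) a (b + 1)).2 e
      calc _ ≤ ω * (QY 1 a (b + 1) e + QX 1 a (b + 1) e) :=
            mul_le_mul_of_nonneg_right (hω b) (by linarith)
        _ ≤ ω * (M + K) := mul_le_mul_of_nonneg_left (add_le_add ih (hX _ _))
            ((ww_nonneg (0 + 1) e).trans (hω 0))
        _ ≤ M := hc

theorem QY_one (a e : ℕ) : QY 1 a 1 e = ww 0 e := by
  rw [QY_succ, one_mul, add_comm, Q_b0, mul_one]

theorem Q4 (a b : ℕ) : QX 1 a b 4 + QY 1 a b 4 ≤ 1 := by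
  rcases b with _ | b
  · rw [Q_b0]
  · have := Q_tail 1 le_rfl a b 4 (by norm_num)
    norm_num at this
    linarith

theorem Q3 (a b : ℕ) : QX 1 a b 3 + QY 1 a b 3 ≤ 2 := by
  have hX := QX_le_of 3 1 (by norm_num) Q4
  have hY := QY_le_of 3 1 1 (1 / 2) le_rfl hX (fun a => by rw [QY_one]; norm_num [ww])
    (fun b => (ww_le _ _).trans (by norm_num)) (by norm_num)
  linarith [hX a b, hY a b]

theorem Q2 (a b : ℕ) : QX 1 a b 2 + QY 1 a b 2 ≤ 8 := by
  have hX := QX_le_of 2 2 (by norm_num) Q3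
  have hY := QY_le_of 2 2 6 (3 / 4) (by norm_num) hX (fun a => by rw [QY_one]; norm_num [ww])
    (fun b => (ww_le _ _).trans (by norm_num)) (by norm_num)
  linarith [hX a b, hY a b]

theorem Q1 (a b : ℕ) : QX 1 a b 1 + QY 1 a b 1 ≤ 32 := by
  have hX := QX_le_of 1 8 (by norm_num) Q2
  have hY := QY_le_of 1 8 24 (3 / 4) (by norm_num) hX (fun a => by rw [QY_one]; norm_num [ww])
    (fun b => by
      unfold ww
      rw [div_le_div_iff₀ (by positivity) (by norm_num)]
      push_cast
      have : (0 : ℚ) ≤ b := by positivity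
      linarith) (by norm_num)
  linarith [hX a b, hY a b]

theorem Q0 (a b : ℕ) : QX 1 a b 0 + QY 1 a b 0 ≤ 33 * (b + 1) := by
  have hX := QX_le_of 0 32 (by norm_num) Q1
  have hY : ∀ b : ℕ, QY 1 a b 0 ≤ 1 + 32 * b := by
    intro b
    induction b with
    | zero => have := QY_b0_le a 0; simpa using this
    | succ b ih =>
      rw [QY_succ, one_mul]
      have : ww b 0 = 1 := by
        unfold ww
        have : (b : ℚ) + 1 ≠ 0 := by positivity
        simp [this]
      rw [this]
      push_cast
      linarith [hX a b]
  have : (0 : ℚ) ≤ b := by positivity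
  linarith [hX a b, hY b]

def ss (T t : ℕ) : ℕ := t.factorial * (T - t).factorial * 2 ^ (t * (T - t))

theorem geo_sum (f : ℕ → ℕ) (n : ℕ) (h : ∀ x, x < n → 2 * f (x + 1) ≤ f x) :
    ∑ x ∈ Finset.range (n + 1), f x + f n ≤ 2 * f 0 := by
  induction n with
  | zero => simp; omega
  | succ n ih =>
    have h1 := ih (fun x hx => h x (by omega))
    have h2 := h n (by omega)
    rw [Finset.sum_range_succ]
    omega

theorem four_pow_ge (x : ℕ) : 3 * x + 1 ≤ 4 ^ x := by
  induction x with
  | zero => simp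
  | succ x ih => rw [pow_succ]; omega

theorem ss_step (l x : ℕ) (hl : 1 ≤ l) (hx : x < 2 * l + 1) :
    2 * ss (4 * l + 3) (2 * l + 2 + (x + 1)) ≤ ss (4 * l + 3) (2 * l + 2 + x) := by
  obtain ⟨y, hy⟩ : ∃ y, 2 * l + 1 = x + (y + 1) := ⟨2 * l - x, by omega⟩
  unfold ss
  rw [show 4 * l + 3 - (2 * l + 2 + (x + 1)) = y by omega,
    show 4 * l + 3 - (2 * l + 2 + x) = y + 1 by omega,
    show 2 * l + 2 = x + y + 2 by omega, show x + y + 2 + (x + 1) = (2 * x + y + 2) + 1 by ring,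
    show x + y + 2 + x = 2 * x + y + 2 by ring, Nat.factorial_succ, Nat.factorial_succ y]
  have hexp : (2 * x + y + 2) * (y + 1) = (2 * x + y + 2 + 1) * y + (2 * x + 2) := by ring
  rw [hexp, pow_add]
  have h4 : 2 * (2 * x + y + 3) ≤ (y + 1) * 2 ^ (2 * x + 2) := by
    have := four_pow_ge x
    rw [show 2 * x + 2 = 2 * (x + 1) by ring, pow_mul, pow_succ]
    norm_num
    rcases Nat.eq_zero_or_pos x with rfl | hx0
    · simp; omega
    · nlinarith [Nat.mul_le_mul_left (y + 1) this]
  generalize (2 * x + y + 2).factorial = A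
  generalize y.factorial = B
  generalize 2 ^ ((2 * x + y + 2 + 1) * y) = C
  calc _ = A * B * C * (2 * (2 * x + y + 3)) := by ring
    _ ≤ A * B * C * ((y + 1) * 2 ^ (2 * x + 2)) := Nat.mul_le_mul_left _ h4
    _ = _ := by ring

theorem ss_sum (l : ℕ) (hl : 1 ≤ l) :
    ∑ t ∈ Finset.range (4 * l + 3 + 1), ss (4 * l + 3) t
      ≤ 4 * ((2 * l + 2).factorial * (2 * l + 1).factorial * 2 ^ ((2 * l + 2) * (2 * l + 1))) := by
  rw [show 4 * l + 3 + 1 = (2 * l + 2) + (2 * l + 2) by ring, Finset.sum_range_add]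
  have h1 := geo_sum (fun x => ss (4 * l + 3) (2 * l + 2 + x)) (2 * l + 1)
    (fun x hx => ss_step l x hl hx)
  have h2 : ∑ t ∈ Finset.range (2 * l + 2), ss (4 * l + 3) t
      = ∑ t ∈ Finset.range (2 * l + 2), ss (4 * l + 3) (2 * l + 2 + t) := by
    rw [← Finset.sum_range_reflect]
    apply Finset.sum_congr rfl
    intro x hx
    simp only [Finset.mem_range] at hx
    unfold ss
    rw [show 4 * l + 3 - (2 * l + 2 - 1 - x) = 2 * l + 2 + x by omega,
      show 4 * l + 3 - (2 * l + 2 + x) = 2 * l + 2 - 1 - x by omega]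
    ring
  have h3 : ss (4 * l + 3) (2 * l + 2 + 0)
      = (2 * l + 2).factorial * (2 * l + 1).factorial * 2 ^ ((2 * l + 2) * (2 * l + 1)) := by
    unfold ss
    rw [show 4 * l + 3 - (2 * l + 2 + 0) = 2 * l + 1 by omega, add_zero]
  rw [h2, ← h3]
  simp only [show 2 * l + 1 + 1 = 2 * l + 2 by ring] at h1
  clear h2 h3
  generalize ss (4 * l + 3) (2 * l + 2 + 0) = a at *
  linarith

theorem pow_big (m : ℕ) (hm : 20 ≤ m) : 1056 * m ^ 2 ≤ 2 ^ m := by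
  induction m, hm using Nat.le_induction with
  | base => norm_num
  | succ m hm ih => rw [pow_succ 2 m]; nlinarith

theorem central (l : ℕ) (hl : 1 ≤ l) :
    4 ^ (2 * l + 2) * ((2 * l + 2).factorial * (2 * l + 1).factorial)
      < (4 * l + 4) * (4 * l + 3).factorial := by
  have h1 := Nat.four_pow_lt_mul_centralBinom (2 * l + 2) (by omega)
  have h2 := Nat.choose_mul_factorial_mul_factorial
    (show 2 * l + 2 ≤ 2 * (2 * l + 2) by omega)
  rw [show 2 * (2 * l + 2) - (2 * l + 2) = 2 * l + 2 by omega, ← Nat.centralBinom_eq_two_mul_choose,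
    show (2 * (2 * l + 2)).factorial = (4 * l + 4) * (4 * l + 3).factorial by
      rw [show 2 * (2 * l + 2) = (4 * l + 3) + 1 by ring, Nat.factorial_succ]] at h2
  have h3 : (2 * l + 2).factorial = (2 * l + 2) * (2 * l + 1).factorial := Nat.factorial_succ _
  rw [← h2]
  have hpos : 0 < (2 * l + 2).factorial * (2 * l + 1).factorial := by positivity
  calc _ < (2 * l + 2) * (2 * l + 2).centralBinom *
        ((2 * l + 2).factorial * (2 * l + 1).factorial) := Nat.mul_lt_mul_of_pos_right h1 hpos
    _ = _ := by rw [h3]; ring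

theorem nat_ineq (l : ℕ) (hl : 19 ≤ l) :
    2 ^ ((l + 1) * (4 * l + 3)) * (132 * (l + 1)) *
      (4 * ((2 * l + 2).factorial * (2 * l + 1).factorial * 2 ^ ((2 * l + 2) * (2 * l + 1))))
      < (4 * l + 3).factorial * 2 ^ ((4 * l + 3).choose 2) := by
  have hch : (4 * l + 3).choose 2 = 8 * l ^ 2 + 10 * l + 3 := by
    rw [Nat.choose_two_right, show 4 * l + 3 - 1 = 2 * (2 * l + 1) by omega,
      show (4 * l + 3) * (2 * (2 * l + 1)) = 2 * (8 * l ^ 2 + 10 * l + 3) by ring]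
    simp
  rw [hch]
  have h1 := central l (by omega)
  have h2 := pow_big (l + 1) (by omega)
  generalize hX : (2 * l + 2).factorial * (2 * l + 1).factorial = X at *
  generalize (4 * l + 3).factorial = F at *
  apply lt_of_mul_lt_mul_left (a := 4 * l + 4) _ (Nat.zero_le _)
  calc (4 * l + 4) * (2 ^ ((l + 1) * (4 * l + 3)) * (132 * (l + 1)) *
      (4 * (X * 2 ^ ((2 * l + 2) * (2 * l + 1)))))
      = (2 * (1056 * (l + 1) ^ 2)) * X * 2 ^ ((l + 1) * (4 * l + 3) + (2 * l + 2) * (2 * l + 1)) := by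
        rw [pow_add]; ring
    _ ≤ (2 * 2 ^ (l + 1)) * X * 2 ^ ((l + 1) * (4 * l + 3) + (2 * l + 2) * (2 * l + 1)) := by
        gcongr
    _ = (4 ^ (2 * l + 2) * X) * 2 ^ (8 * l ^ 2 + 10 * l + 3) := by
        rw [show (4 : ℕ) = 2 ^ 2 by norm_num, ← pow_mul]
        have : 2 * 2 ^ (l + 1) * 2 ^ ((l + 1) * (2 ^ 2 * l + 3) + (2 * l + 2) * (2 * l + 1))
          = 2 ^ (2 * (2 * l + 2)) * 2 ^ (8 * l ^ 2 + 10 * l + 3) := by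
          rw [← pow_succ', ← pow_add, ← pow_add]
          congr 1
          ring
        linear_combination X * this
    _ < ((4 * l + 4) * F) * 2 ^ (8 * l ^ 2 + 10 * l + 3) :=
        Nat.mul_lt_mul_of_pos_right h1 (by positivity)
    _ = _ := by ring

theorem Ex2_big (k m : ℕ) (hm : 20 ≤ m) (hk : k + 1 ≤ 2 ^ m) :
    Ex k (2 * (k + 1)) (4 * m - 1) < 1 := by
  obtain ⟨l, rfl⟩ : ∃ l, m = l + 1 := ⟨m - 1, by omega⟩
  rw [show 4 * (l + 1) - 1 = 4 * l + 3 by omega]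
  have h1 := Ex2_scaled k (4 * l + 3) (2 ^ ((l + 1) * (4 * l + 3))) 1 (fun d hd => by
    rw [one_pow, mul_one]
    obtain ⟨s, hs⟩ : ∃ s, 4 * l + 3 = 2 * d + 1 + s := ⟨4 * l + 3 - (2 * d + 1), by omega⟩
    have e1 : (k + 1 + d).descFactorial (4 * l + 3) ≤ (2 ^ (l + 1) + d).descFactorial (4 * l + 3) :=
      Nat.descFactorial_le _ (by omega)
    have e2 := desc_all (2 ^ (l + 1)) d s
    rw [← hs, ← pow_mul] at e2
    exact_mod_cast e1.trans e2)
  have h2 : ∑ t ∈ Finset.range (4 * l + 3 + 1),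
      (t.factorial : ℚ) * (4 * l + 3 - t).factorial * 2 ^ (t * (4 * l + 3 - t)) *
        (QX 1 t (4 * l + 3 - t) 0 + QY 1 t (4 * l + 3 - t) 0)
      ≤ ((132 * (l + 1) * ∑ t ∈ Finset.range (4 * l + 3 + 1), ss (4 * l + 3) t : ℕ) : ℚ) := by
    push_cast
    rw [Finset.mul_sum]
    apply Finset.sum_le_sum
    intro t ht
    rw [mul_comm]
    unfold ss
    push_cast
    apply mul_le_mul_of_nonneg_right _ (by positivity)
    refine (Q0 _ _).trans ?_
    have : ((4 * l + 3 - t : ℕ) : ℚ) ≤ 4 * l + 3 := by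
      exact_mod_cast Nat.sub_le _ _
    linarith
  have h3 : (((2 ^ ((l + 1) * (4 * l + 3)) * (132 * (l + 1) *
      ∑ t ∈ Finset.range (4 * l + 3 + 1), ss (4 * l + 3) t) : ℕ)) : ℚ)
      < (4 * l + 3).factorial * 2 ^ ((4 * l + 3).choose 2) := by
    have e1 := nat_ineq l (by omega)
    have e2 := ss_sum l (by omega)
    have e3 : (2 ^ ((l + 1) * (4 * l + 3)) * (132 * (l + 1) *
      ∑ t ∈ Finset.range (4 * l + 3 + 1), ss (4 * l + 3) t))
      < (4 * l + 3).factorial * 2 ^ ((4 * l + 3).choose 2) := by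
      refine lt_of_le_of_lt ?_ e1
      rw [← mul_assoc (2 ^ ((l + 1) * (4 * l + 3))) (132 * (l + 1))]
      exact Nat.mul_le_mul_left _ e2
    exact_mod_cast e3
  have h4 := h1.trans (mul_le_mul_of_nonneg_left h2 (by positivity))
  push_cast at h3 h4
  have hF : (0 : ℚ) < (4 * l + 3).factorial * 2 ^ ((4 * l + 3).choose 2) := by positivity
  have h5 := lt_of_le_of_lt h4 h3
  by_contra hcon
  push Not at hcon
  nlinarith

theorem Ex2_lt (k m : ℕ) (hm : 2 ≤ m) (hk : k + 1 ≤ 2 ^ m) :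
    Ex k (2 * (k + 1)) (4 * m - 1) < 1 := by
  rcases Nat.lt_or_ge m 3 with h | h
  · have : m = 2 := by omega
    subst this
    exact Ex2_two k (by simpa using hk)
  · rcases Nat.lt_or_ge m 20 with h' | h'
    · exact Ex2_mid k m h (by omega) hk
    · exact Ex2_big k m h' hk

theorem stmt13 (k : ℕ) (hk : 2 ≤ k) (i : ℕ) :
    ∃ A : Fin (k + 2 + i * (k + 1)) → Fin (k + 2 + i * (k + 1)) → Prop,
      (∀ u v, A u v → ¬ A v u) ∧
      TreewidthLE (SimpleGraph.fromRel A) k ∧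
      ∀ F : Set (Fin (k + 2 + i * (k + 1))), DirFVS A F →
        (i + 1) * (k - 2 * Nat.log 2 k) ≤ F.ncard := by
  have hm : 2 ≤ Nat.log 2 k + 1 := by
    have := Nat.log_pos (b := 2) (by norm_num) hk
    omega
  have hk' : k + 1 ≤ 2 ^ (Nat.log 2 k + 1) := Nat.lt_pow_succ_log_self (by norm_num) k
  exact main_of_Ex k i (Ex1_lt k _ hm hk') (Ex2_lt k _ hm hk')
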